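/- arXiv:1812.02680 — 2 statements merged into one kernel-verified Lean document; each statement's English description precedes it below -/
import Mathlib

section
/- Under the hypotheses of Theorem 1 (A(u) = C⁻¹ diag(a_1(u),…,a_n(u)) C with C orthogonal and a_j(u) > 0 μ-measurable, u ↦ |Φ(u)|(a_1(u)⋯a_n(u))^{-1/2} μ-integrable, T a continuous linear operator on L²(ℝⁿ;ℂ) realizing H_{Φ,A}), the operator norm of T equals sup_{s ∈ ℝⁿ} |φ(s)|, where φ is the symbol of T. If in addition Φ(u) ≥ 0 for μ-a.e. u, then ‖T‖ = ∫_Ω Φ(u) (det A(u))^{-1/2} dμ(u). -/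
open MeasureTheory Complex Filter Matrix
open scoped ENNReal ComplexConjugate

open scoped FourierTransform SchwartzMap InnerProductSpace Topology

section Convolution

theorem lintegral_enorm_mul_enorm_le {X : Type*} [MeasurableSpace X] {m : Measure X}
    {f g : X → ℂ} (hf : AEStronglyMeasurable f m) (hg : AEStronglyMeasurable g m) :
    ∫⁻ x, ‖f x‖ₑ * ‖g x‖ₑ ∂m ≤ eLpNorm f 2 m * eLpNorm g 2 m := by
  have h := ENNReal.lintegral_mul_le_Lp_mul_Lq m Real.HolderConjugate.two_two
    hf.enorm hg.enorm
  rw [eLpNorm_eq_lintegral_rpow_enorm_toReal (by norm_num) (by norm_num),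
    eLpNorm_eq_lintegral_rpow_enorm_toReal (by norm_num) (by norm_num)]
  simpa using h

variable {V : Type*} [NormedAddCommGroup V] [InnerProductSpace ℝ V] [FiniteDimensional ℝ V]
  [MeasurableSpace V] [BorelSpace V]

theorem SchwartzMap.integral_inner_translate (g k : 𝓢(V, ℂ)) (t : V) :
    ∫ y, inner ℂ (k y) (g (t + y)) =
      ∫ ξ, (𝐞 (inner ℝ t ξ) : ℂ) * inner ℂ (𝓕 k ξ) (𝓕 g ξ) := by
  have h := SchwartzMap.integral_inner_fourier_fourier k (g.compSubConstCLM ℂ (-t))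
  have h2 : ∀ ξ, 𝓕 (g.compSubConstCLM ℂ (-t)) ξ = 𝐞 (inner ℝ t ξ) • 𝓕 g ξ := by
    intro ξ
    rw [SchwartzMap.fourier_coe, SchwartzMap.fourier_coe]
    have h3 := congrFun (VectorFourier.fourierIntegral_comp_add_right 𝐞 volume
      (innerₗ V) (g : V → ℂ) t) ξ
    have h4 : ((g.compSubConstCLM ℂ (-t) : 𝓢(V, ℂ)) : V → ℂ) = (g : V → ℂ) ∘ fun v => v + t := by
      ext x; simp [SchwartzMap.compSubConstCLM_apply]
    rw [h4]
    exact h3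
  simp only [h2, SchwartzMap.compSubConstCLM_apply, sub_neg_eq_add] at h
  simp only [add_comm t]
  rw [← h]
  refine integral_congr_ae (.of_forall fun ξ => ?_)
  simp [Circle.smul_def]; ring

theorem SchwartzMap.eLpNorm_fourier_two (g : 𝓢(V, ℂ)) :
    eLpNorm (𝓕 g : 𝓢(V, ℂ)) 2 volume = ENNReal.ofReal ‖g.toLp 2‖ := by
  rw [← SchwartzMap.norm_fourier_toL2_eq g]
  generalize (𝓕 g : 𝓢(V, ℂ)) = f
  rw [SchwartzMap.norm_toLp]
  exact (ENNReal.ofReal_toReal (f.memLp 2 volume).eLpNorm_ne_top).symm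

variable {Ω : Type*} [MeasurableSpace Ω] {μ : Measure Ω} [SigmaFinite μ]
  {ψ : Ω → ℂ} {l : Ω → V}

theorem norm_integral_mul_integral_inner_translate_le (hψ : Integrable ψ μ) (hl : Measurable l)
    {M : ℝ} (hM : ∀ s : V, ‖∫ u, ψ u * cexp (I * (inner ℝ (l u) s : ℝ)) ∂μ‖ ≤ M)
    (g k : 𝓢(V, ℂ)) :
    ‖∫ u, ψ u * (∫ y, inner ℂ (k y) (g (l u + y))) ∂μ‖ ≤ M * (‖g.toLp 2‖ * ‖k.toLp 2‖) := by
  have hM0 : 0 ≤ M := (norm_nonneg _).trans (hM 0)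
  have hker : Integrable (fun ξ : V => inner ℂ (𝓕 k ξ) (𝓕 g ξ)) := by
    have := L2.integrable_inner (𝕜 := ℂ) ((𝓕 k).toLp 2) ((𝓕 g).toLp 2)
    refine this.congr ?_
    filter_upwards [(𝓕 k).coeFn_toLp 2, (𝓕 g).coeFn_toLp 2] with ξ h1 h2
    rw [h1, h2]
  have hmeas : Measurable fun p : Ω × V => ((𝐞 (inner ℝ (l p.1) p.2) : Circle) : ℂ) := by
    have : Continuous fun r : ℝ => ((𝐞 r : Circle) : ℂ) := by fun_prop
    exact this.measurable.comp ((hl.comp measurable_fst).inner measurable_snd)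
  have hint : Integrable (fun p : Ω × V =>
      ψ p.1 * ((𝐞 (inner ℝ (l p.1) p.2) : Circle) * inner ℂ (𝓕 k p.2) (𝓕 g p.2)))
      (μ.prod volume) := by
    have := (hψ.mul_prod hker).bdd_mul (c := 1) hmeas.aestronglyMeasurable
      (.of_forall fun p => (Circle.norm_coe _).le)
    refine this.congr (.of_forall fun p => ?_)
    simp only; ring
  simp only [SchwartzMap.integral_inner_translate, ← integral_const_mul]
  rw [integral_integral_swap hint]
  have hin : ∀ ξ : V, ‖∫ u, ψ u * ((𝐞 (inner ℝ (l u) ξ) : Circle) * inner ℂ (𝓕 k ξ) (𝓕 g ξ)) ∂μ‖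
      ≤ M * (‖𝓕 g ξ‖ * ‖𝓕 k ξ‖) := by
    intro ξ
    have : ∀ u, ψ u * ((𝐞 (inner ℝ (l u) ξ) : Circle) * inner ℂ (𝓕 k ξ) (𝓕 g ξ)) =
        (ψ u * cexp (I * (inner ℝ (l u) ((2 * Real.pi) • ξ) : ℝ))) * inner ℂ (𝓕 k ξ) (𝓕 g ξ) := by
      intro u
      rw [Real.fourierChar_apply, inner_smul_right]
      push_cast
      rw [mul_comm I]; ring_nf
    simp only [this]
    rw [integral_mul_const, norm_mul]
    refine mul_le_mul (hM _) ?_ (norm_nonneg _) hM0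
    rw [mul_comm]
    exact norm_inner_le_norm _ _
  refine (norm_integral_le_lintegral_norm _).trans ?_
  refine ENNReal.toReal_le_of_le_ofReal (by positivity) ?_
  calc _ ≤ ∫⁻ ξ, ENNReal.ofReal M * (‖𝓕 g ξ‖ₑ * ‖𝓕 k ξ‖ₑ) := by
        refine lintegral_mono fun ξ => ?_
        refine (ENNReal.ofReal_le_ofReal (hin ξ)).trans_eq ?_
        rw [ENNReal.ofReal_mul hM0, ENNReal.ofReal_mul (norm_nonneg _), ofReal_norm, ofReal_norm]
    _ = ENNReal.ofReal M * ∫⁻ ξ, (‖𝓕 g ξ‖ₑ * ‖𝓕 k ξ‖ₑ) := lintegral_const_mul' _ _ (by simp)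
    _ ≤ ENNReal.ofReal M *
        (eLpNorm (𝓕 g : 𝓢(V, ℂ)) 2 volume * eLpNorm (𝓕 k : 𝓢(V, ℂ)) 2 volume) := by
        gcongr
        exact lintegral_enorm_mul_enorm_le (𝓕 g : 𝓢(V, ℂ)).continuous.aestronglyMeasurable
          (𝓕 k : 𝓢(V, ℂ)).continuous.aestronglyMeasurable
    _ = _ := by
        rw [ENNReal.ofReal_mul hM0, ENNReal.ofReal_mul (norm_nonneg _),
          SchwartzMap.eLpNorm_fourier_two, SchwartzMap.eLpNorm_fourier_two]

/-- The sesquilinear form `(g, k) ↦ ∫ ψ(u) ⟪k, g(l(u) + ·)⟫ dμ(u)` is bounded by the supremum of the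
Fourier transform of the complex measure `l_*(ψ μ)`. -/
theorem norm_integral_mul_inner_vadd_le (hψ : Integrable ψ μ) (hl : Measurable l)
    {M : ℝ} (hM : ∀ s : V, ‖∫ u, ψ u * cexp (I * (inner ℝ (l u) s : ℝ)) ∂μ‖ ≤ M)
    (g k : Lp ℂ 2 (volume : Measure V)) :
    ‖∫ u, ψ u * inner ℂ k (DomAddAct.mk (l u) +ᵥ g) ∂μ‖ ≤ M * (‖g‖ * ‖k‖) := by
  have : Fact ((2 : ℝ≥0∞) ≠ ∞) := ⟨ENNReal.ofNat_ne_top⟩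
  have hvadd : Continuous fun p : V × Lp ℂ 2 (volume : Measure V) => DomAddAct.mk p.1 +ᵥ p.2 := by
    have : Continuous (DomAddAct.mk : V → Vᵈᵃᵃ) := DomAddAct.continuous_mk
    exact (this.comp continuous_fst).vadd continuous_snd
  have hcont : Continuous fun p : Lp ℂ 2 (volume : Measure V) × Lp ℂ 2 (volume : Measure V) =>
      ∫ u, ψ u * inner ℂ p.2 (DomAddAct.mk (l u) +ᵥ p.1) ∂μ := by
    rw [continuous_iff_continuousAt]
    rintro ⟨g₀, k₀⟩
    refine continuousAt_of_dominated
      (bound := fun u => ‖ψ u‖ * ((‖k₀‖ + 1) * (‖g₀‖ + 1))) ?_ ?_ ?_ ?_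
    · refine .of_forall fun p => hψ.1.mul ?_
      have h1 : Continuous fun t : V => (inner ℂ p.2 (DomAddAct.mk t +ᵥ p.1) : ℂ) :=
        continuous_const.inner (hvadd.comp (by fun_prop : Continuous fun t : V => (t, p.1)))
      exact (h1.measurable.comp hl).aestronglyMeasurable
    · filter_upwards [Metric.ball_mem_nhds (g₀, k₀) one_pos] with p hp
      refine .of_forall fun u => ?_
      rw [norm_mul]
      gcongr
      refine (norm_inner_le_norm _ _).trans ?_
      rw [DomAddAct.norm_vadd_Lp]
      rw [Metric.mem_ball, Prod.dist_eq, max_lt_iff, dist_eq_norm, dist_eq_norm] at hp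
      have h1 := norm_le_norm_add_norm_sub' p.1 g₀
      have h2 := norm_le_norm_add_norm_sub' p.2 k₀
      simp only at hp
      gcongr <;> linarith [hp.1, hp.2]
    · exact hψ.norm.mul_const _
    · refine .of_forall fun u => Continuous.continuousAt ?_
      exact continuous_const.mul (continuous_snd.inner
        (hvadd.comp (continuous_const.prodMk continuous_fst)))
  have hd := SchwartzMap.denseRange_toLpCLM (F := ℂ) (E := V) (p := 2) (μ := volume)
    ENNReal.ofNat_ne_top
  have hcl : IsClosed {p : Lp ℂ 2 (volume : Measure V) × Lp ℂ 2 (volume : Measure V) |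
      ‖∫ u, ψ u * inner ℂ p.2 (DomAddAct.mk (l u) +ᵥ p.1) ∂μ‖ ≤ M * (‖p.1‖ * ‖p.2‖)} :=
    isClosed_le hcont.norm (by fun_prop)
  refine (hd.prodMap hd).induction_on
    (p := fun p => ‖∫ u, ψ u * inner ℂ p.2 (DomAddAct.mk (l u) +ᵥ p.1) ∂μ‖ ≤ M * (‖p.1‖ * ‖p.2‖))
    (g, k) hcl ?_
  rintro ⟨g, k⟩
  refine le_of_eq_of_le ?_ (norm_integral_mul_integral_inner_translate_le hψ hl hM g k)
  congr 1
  refine integral_congr_ae (.of_forall fun u => ?_)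
  simp only [Prod.map, SchwartzMap.toLpCLM_apply]
  congr 1
  rw [L2.inner_def]
  refine integral_congr_ae ?_
  have h1 := DomAddAct.vadd_Lp_ae_eq (DomAddAct.mk (l u)) (g.toLp 2 (volume : Measure V))
  have h2 := (quasiMeasurePreserving_add_left (volume : Measure V) (l u)).ae (g.coeFn_toLp 2 volume)
  filter_upwards [h1, h2, k.coeFn_toLp 2 volume] with y h1 h2 h3
  rw [h1, h3]
  simp only [Equiv.symm_apply_apply, vadd_eq_add, h2]

theorem integrable_inner_mul_translate (hψ : Integrable ψ μ) (hl : Measurable l) {g k : V → ℂ}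
    (hgm : StronglyMeasurable g) (hg : MemLp g 2) (hk : MemLp k 2) :
    Integrable (fun p : V × Ω => inner ℂ (k p.1) (ψ p.2 * g (l p.2 + p.1)))
      ((volume : Measure V).prod μ) := by
  have hmeas : AEStronglyMeasurable (fun p : V × Ω => inner ℂ (k p.1) (ψ p.2 * g (l p.2 + p.1)))
      ((volume : Measure V).prod μ) := by
    refine hk.1.comp_fst.inner (hψ.1.comp_snd.mul ?_)
    exact (hgm.comp_measurable
      ((hl.comp measurable_snd).add measurable_fst)).aestronglyMeasurable
  refine ⟨hmeas, ?_⟩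
  rw [hasFiniteIntegral_iff_enorm, lintegral_prod_symm _ hmeas.enorm]
  calc _ ≤ ∫⁻ u, ‖ψ u‖ₑ * (eLpNorm k 2 volume * eLpNorm g 2 volume) ∂μ := by
        refine lintegral_mono fun u => ?_
        have hmp := measurePreserving_add_left (volume : Measure V) (l u)
        have h1 := lintegral_enorm_mul_enorm_le hk.1 (hg.1.comp_measurePreserving hmp)
        rw [eLpNorm_comp_measurePreserving hg.1 hmp] at h1
        simp only [Function.comp_apply] at h1
        refine le_trans (le_of_eq ?_) (mul_le_mul_right h1 ‖ψ u‖ₑ)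
        rw [← lintegral_const_mul' _ _ (by simp)]
        refine lintegral_congr fun y => ?_
        simp only [RCLike.inner_apply, enorm_mul, RCLike.enorm_conj]
        ring
    _ = (∫⁻ u, ‖ψ u‖ₑ ∂μ) * (eLpNorm k 2 volume * eLpNorm g 2 volume) :=
        lintegral_mul_const' _ _ (ENNReal.mul_ne_top hk.eLpNorm_ne_top hg.eLpNorm_ne_top)
    _ < ∞ := ENNReal.mul_lt_top hψ.2 (ENNReal.mul_lt_top hk.2 hg.2)

theorem integral_inner_integral_translate (hψ : Integrable ψ μ) (hl : Measurable l) {g k : V → ℂ}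
    (hgm : StronglyMeasurable g) (hg : MemLp g 2) (hk : MemLp k 2) :
    ∫ y, inner ℂ (k y) (∫ u, ψ u * g (l u + y) ∂μ) =
      ∫ u, ψ u * (∫ y, inner ℂ (k y) (g (l u + y))) ∂μ := by
  have hint := integrable_inner_mul_translate hψ hl hgm hg hk
  have h1 := integral_integral_swap
    (f := fun y u => inner ℂ (k y) (ψ u * g (l u + y))) hint
  calc _ = ∫ y, ∫ u, inner ℂ (k y) (ψ u * g (l u + y)) ∂μ := by
        refine integral_congr_ae (.of_forall fun y => ?_)
        simp only [RCLike.inner_apply]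
        rw [integral_mul_const]
    _ = _ := h1
    _ = _ := by
        refine integral_congr_ae (.of_forall fun u => ?_)
        simp only
        rw [← integral_const_mul]
        refine integral_congr_ae (.of_forall fun y => ?_)
        simp only [RCLike.inner_apply]
        ring

theorem eLpNorm_integral_translate_le (hψ : Integrable ψ μ) (hl : Measurable l) {M : ℝ}
    (hM : ∀ s : V, ‖∫ u, ψ u * cexp (I * (inner ℝ (l u) s : ℝ)) ∂μ‖ ≤ M) {g : V → ℂ}
    (hgm : StronglyMeasurable g) (hg : MemLp g 2)
    (hh : MemLp (fun y => ∫ u, ψ u * g (l u + y) ∂μ) 2) :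
    eLpNorm (fun y => ∫ u, ψ u * g (l u + y) ∂μ) 2 volume ≤
      ENNReal.ofReal M * eLpNorm g 2 volume := by
  have hM0 : 0 ≤ M := (norm_nonneg _).trans (hM 0)
  have key := integral_inner_integral_translate hψ hl hgm hg hh
  set h : V → ℂ := fun y => ∫ u, ψ u * g (l u + y) ∂μ with hdef
  have h1 : ∫ y, inner ℂ (h y) (h y) = inner ℂ (hh.toLp h) (hh.toLp h) := by
    rw [L2.inner_def]
    refine integral_congr_ae ?_
    filter_upwards [hh.coeFn_toLp] with y hy
    rw [hy]
  have h2 : ∀ u, ∫ y, inner ℂ (h y) (g (l u + y)) =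
      inner ℂ (hh.toLp h) (DomAddAct.mk (l u) +ᵥ hg.toLp g) := by
    intro u
    rw [L2.inner_def]
    refine integral_congr_ae ?_
    have h3 := DomAddAct.vadd_Lp_ae_eq (DomAddAct.mk (l u)) (hg.toLp g)
    have h4 := (quasiMeasurePreserving_add_left (volume : Measure V) (l u)).ae hg.coeFn_toLp
    filter_upwards [hh.coeFn_toLp, h3, h4] with y hy h3 h4
    rw [hy, h3]
    simp only [Equiv.symm_apply_apply, vadd_eq_add, h4]
  have h5 := norm_integral_mul_inner_vadd_le hψ hl hM (hg.toLp g) (hh.toLp h)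
  simp only [← h2] at h5
  rw [← key] at h5
  change ‖∫ y, inner ℂ (h y) (h y)‖ ≤ _ at h5
  rw [h1, inner_self_eq_norm_sq_to_K, norm_pow, RCLike.norm_ofReal, abs_norm, sq] at h5
  have h6 : ‖hh.toLp h‖ ≤ M * ‖hg.toLp g‖ := by
    rcases (norm_nonneg (hh.toLp h)).eq_or_lt with h0 | h0
    · rw [← h0]; positivity
    · rw [← mul_assoc] at h5
      exact le_of_mul_le_mul_right h5 h0
  rw [Lp.norm_toLp, Lp.norm_toLp] at h6
  calc eLpNorm h 2 volume = ENNReal.ofReal (eLpNorm h 2 volume).toReal :=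
        (ENNReal.ofReal_toReal hh.eLpNorm_ne_top).symm
    _ ≤ ENNReal.ofReal (M * (eLpNorm g 2 volume).toReal) := ENNReal.ofReal_le_ofReal h6
    _ = _ := by rw [ENNReal.ofReal_mul hM0, ENNReal.ofReal_toReal hg.eLpNorm_ne_top]

theorem norm_integral_mul_gaussian_le (hψ : Integrable ψ μ) (hl : Measurable l) {K : ℝ} (hK : 0 ≤ K)
    (h : ∀ g : V → ℂ, StronglyMeasurable g → MemLp g 2 →
      MemLp (fun y => ∫ u, ψ u * g (l u + y) ∂μ) 2 ∧
      eLpNorm (fun y => ∫ u, ψ u * g (l u + y) ∂μ) 2 volume ≤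
        ENNReal.ofReal K * eLpNorm g 2 volume) (s : V) {δ : ℝ} (hδ : 0 < δ) :
    ‖∫ u, ψ u * (cexp (I * (inner ℝ (l u) s : ℝ)) * (Real.exp (-(δ / 2) * ‖l u‖ ^ 2) : ℝ)) ∂μ‖
      ≤ K := by
  set g : V → ℂ := fun y => cexp (I * (inner ℝ y s : ℝ)) * (Real.exp (-δ * ‖y‖ ^ 2) : ℝ) with hgdef
  have hgc : Continuous g := by fun_prop
  have hnorm : ∀ y, ‖g y‖ = Real.exp (-δ * ‖y‖ ^ 2) := by
    intro y
    rw [hgdef]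
    simp only [norm_mul, Complex.norm_real, Real.norm_eq_abs, Real.abs_exp]
    rw [mul_comm I, Complex.norm_exp_ofReal_mul_I, one_mul]
  have hgauss : Integrable (fun y : V => Real.exp (-(2 * δ) * ‖y‖ ^ 2)) := by
    have := GaussianFourier.integrable_cexp_neg_mul_sq_norm_add (V := V) (b := ((2 * δ : ℝ) : ℂ))
      (by simpa using hδ) 0 0
    refine this.re.congr (.of_forall fun y => ?_)
    simp only [zero_mul, add_zero]
    rw [show (-((2 * δ : ℝ) : ℂ) * (‖y‖ : ℂ) ^ 2) = ((-(2 * δ) * ‖y‖ ^ 2 : ℝ) : ℂ) by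
      push_cast; ring]
    rw [← Complex.ofReal_exp]
    rfl
  have hg : MemLp g 2 := by
    rw [memLp_two_iff_integrable_sq_norm hgc.aestronglyMeasurable]
    refine hgauss.congr (.of_forall fun y => ?_)
    simp only [hnorm, ← Real.exp_nat_mul]
    congr 1; push_cast; ring
  set c : ℝ := ∫ y : V, Real.exp (-(2 * δ) * ‖y‖ ^ 2) with hc
  have hcpos : 0 < c := integral_exp_pos hgauss
  obtain ⟨hh, hle⟩ := h g hgc.stronglyMeasurable hg
  have key := integral_inner_integral_translate hψ hl hgc.stronglyMeasurable hg hg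
  have htr : ∀ t : V, ∫ y, inner ℂ (g y) (g (t + y)) =
      (cexp (I * (inner ℝ t s : ℝ)) * (Real.exp (-(δ / 2) * ‖t‖ ^ 2) : ℝ)) * c := by
    intro t
    rw [hc, ← integral_complex_ofReal, ← integral_const_mul,
      ← integral_add_left_eq_self _ ((-(1 / 2) : ℝ) • t)]
    refine integral_congr_ae (.of_forall fun y => ?_)
    simp only [RCLike.inner_apply, hgdef, map_mul, ← Complex.exp_conj, Complex.conj_I,
      Complex.conj_ofReal]
    have hn : ‖(-(1 / 2) : ℝ) • t + y‖ ^ 2 = ‖t‖ ^ 2 / 4 - inner ℝ t y + ‖y‖ ^ 2 := by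
      rw [norm_add_sq_real, norm_smul, inner_smul_left, mul_pow, Real.norm_eq_abs, sq_abs]
      simp; ring
    have hn2 : ‖t + ((-(1 / 2) : ℝ) • t + y)‖ ^ 2 = ‖t‖ ^ 2 / 4 + inner ℝ t y + ‖y‖ ^ 2 := by
      rw [show t + ((-(1 / 2) : ℝ) • t + y) = (1 / 2 : ℝ) • t + y by module,
        norm_add_sq_real, norm_smul, inner_smul_left, mul_pow, Real.norm_eq_abs, sq_abs]
      simp; ring
    simp only [hn, hn2, inner_add_left, Complex.ofReal_exp, ← Complex.exp_add]
    congr 1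
    push_cast
    ring
  simp only [htr, ← mul_assoc] at key
  rw [integral_mul_const] at key
  have hbound : ‖∫ y, inner ℂ (g y) (∫ u, ψ u * g (l u + y) ∂μ)‖ ≤ K * c := by
    refine (norm_integral_le_lintegral_norm _).trans ?_
    refine ENNReal.toReal_le_of_le_ofReal (by positivity) ?_
    calc _ ≤ ∫⁻ y, ‖g y‖ₑ * ‖∫ u, ψ u * g (l u + y) ∂μ‖ₑ := by
          refine lintegral_mono fun y => ?_
          rw [ofReal_norm, RCLike.inner_apply, enorm_mul, RCLike.enorm_conj, mul_comm]
      _ ≤ eLpNorm g 2 volume * (ENNReal.ofReal K * eLpNorm g 2 volume) :=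
          (lintegral_enorm_mul_enorm_le hg.1 hh.1).trans (by gcongr)
      _ = ENNReal.ofReal K * eLpNorm g 2 volume ^ 2 := by ring
      _ = ENNReal.ofReal (K * c) := by
          rw [ENNReal.ofReal_mul hK]
          congr 1
          rw [eLpNorm_eq_lintegral_rpow_enorm_toReal (by norm_num) (by norm_num),
            ← ENNReal.rpow_natCast, ← ENNReal.rpow_mul, hc,
            ofReal_integral_eq_lintegral_ofReal hgauss (.of_forall fun y => (Real.exp_pos _).le)]
          simp only [ENNReal.toReal_ofNat, ENNReal.rpow_ofNat]
          norm_num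
          refine lintegral_congr fun y => ?_
          rw [← ofReal_norm, hnorm, ← ENNReal.ofReal_pow (Real.exp_pos _).le, ← Real.exp_nat_mul]
          congr 2; push_cast; ring
  rw [key, norm_mul, Complex.norm_real, Real.norm_of_nonneg hcpos.le] at hbound
  simp only [← mul_assoc]
  exact le_of_mul_le_mul_right hbound hcpos

theorem norm_integral_mul_cexp_le (hψ : Integrable ψ μ) (hl : Measurable l) {K : ℝ} (hK : 0 ≤ K)
    (h : ∀ g : V → ℂ, StronglyMeasurable g → MemLp g 2 →
      MemLp (fun y => ∫ u, ψ u * g (l u + y) ∂μ) 2 ∧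
      eLpNorm (fun y => ∫ u, ψ u * g (l u + y) ∂μ) 2 volume ≤
        ENNReal.ofReal K * eLpNorm g 2 volume) (s : V) :
    ‖∫ u, ψ u * cexp (I * (inner ℝ (l u) s : ℝ)) ∂μ‖ ≤ K := by
  have hlim : Tendsto (fun δ : ℝ => ∫ u, ψ u * (cexp (I * (inner ℝ (l u) s : ℝ)) *
      (Real.exp (-(δ / 2) * ‖l u‖ ^ 2) : ℝ)) ∂μ) (𝓝[>] 0)
      (𝓝 (∫ u, ψ u * cexp (I * (inner ℝ (l u) s : ℝ)) ∂μ)) := by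
    refine tendsto_integral_filter_of_dominated_convergence (fun u => ‖ψ u‖) ?_ ?_ hψ.norm ?_
    · refine .of_forall fun δ => hψ.1.mul (Measurable.aestronglyMeasurable ?_)
      fun_prop
    · filter_upwards [self_mem_nhdsWithin] with δ hδ
      refine .of_forall fun u => ?_
      rw [norm_mul, norm_mul, mul_comm I, Complex.norm_exp_ofReal_mul_I, one_mul,
        Complex.norm_real, Real.norm_of_nonneg (Real.exp_pos _).le]
      refine mul_le_of_le_one_right (norm_nonneg _) (Real.exp_le_one_iff.2 ?_)
      have : (0 : ℝ) < δ := hδ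
      have := mul_nonneg (half_pos this).le (sq_nonneg ‖l u‖)
      linarith
    · refine .of_forall fun u => ?_
      have hc : Continuous fun δ : ℝ => ψ u * (cexp (I * (inner ℝ (l u) s : ℝ)) *
        (Real.exp (-(δ / 2) * ‖l u‖ ^ 2) : ℝ)) := by fun_prop
      simpa using (hc.tendsto 0).mono_left nhdsWithin_le_nhds
  refine le_of_tendsto hlim.norm ?_
  filter_upwards [self_mem_nhdsWithin] with δ hδ
  exact norm_integral_mul_gaussian_le hψ hl hK h s hδ

end Convolution

section SignedExp

variable {n : ℕ}

theorem abs_units_int_cast (e : ℤˣ) : |((e : ℤ) : ℝ)| = 1 := by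
  rcases Int.units_eq_one_or e with h | h <;> simp [h]

/-- The parametrization of the orthant of `ℝⁿ` with signs `ε` by logarithmic coordinates. -/
noncomputable def signedExp (ε : Fin n → ℤˣ) (y : Fin n → ℝ) : Fin n → ℝ :=
  fun j => ((ε j : ℤ) : ℝ) * Real.exp (y j)

theorem signedExp_injective {ε ε' : Fin n → ℤˣ} {y y' : Fin n → ℝ}
    (h : signedExp ε y = signedExp ε' y') : ε = ε' ∧ y = y' := by
  have h1 : ∀ j, ((ε j : ℤ) : ℝ) * Real.exp (y j) = ((ε' j : ℤ) : ℝ) * Real.exp (y' j) :=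
    fun j => congrFun h j
  have h2 : y = y' := by
    ext j
    have h3 := congrArg abs (h1 j)
    rw [abs_mul, abs_mul, abs_units_int_cast, abs_units_int_cast, Real.abs_exp, Real.abs_exp,
      one_mul, one_mul] at h3
    exact Real.exp_injective h3
  subst h2
  refine ⟨funext fun j => ?_, rfl⟩
  have h3 := mul_right_cancel₀ (Real.exp_ne_zero _) (h1 j)
  exact Units.ext (by exact_mod_cast h3)

theorem iUnion_range_signedExp :
    ⋃ ε : Fin n → ℤˣ, Set.range (signedExp ε) = {x | ∀ j, x j ≠ 0} := by
  ext x
  simp only [Set.mem_iUnion, Set.mem_range, Set.mem_ofPred_eq]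
  constructor
  · rintro ⟨ε, y, rfl⟩ j
    simp [signedExp]
  · intro hx
    refine ⟨fun j => if 0 < x j then 1 else -1, fun j => Real.log (x j), funext fun j => ?_⟩
    simp only [signedExp]
    rw [Real.exp_log_eq_abs (hx j)]
    split_ifs with h
    · simp [abs_of_pos h]
    · simp [abs_of_nonpos (not_lt.1 h)]

theorem hasFDerivAt_signedExp (ε : Fin n → ℤˣ) (y : Fin n → ℝ) :
    HasFDerivAt (signedExp ε)
      (LinearMap.toContinuousLinearMap (Matrix.toLin' (Matrix.diagonal (signedExp ε y)))) y := by
  rw [hasFDerivAt_pi']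
  intro j
  have h1 : HasFDerivAt (fun y : Fin n → ℝ => y j)
      (ContinuousLinearMap.proj (R := ℝ) (φ := fun _ : Fin n => ℝ) j) y :=
    (ContinuousLinearMap.proj (R := ℝ) (φ := fun _ : Fin n => ℝ) j).hasFDerivAt
  refine (h1.exp.const_mul ((ε j : ℤ) : ℝ)).congr_fderiv ?_
  ext v
  simp [Matrix.mulVec_diagonal, signedExp, mul_assoc]

theorem lintegral_eq_sum_signedExp (h : (Fin n → ℝ) → ℝ≥0∞) :
    ∫⁻ x, h x = ∑ ε : Fin n → ℤˣ,
      ∫⁻ y : Fin n → ℝ, ENNReal.ofReal (Real.exp (∑ j, y j)) * h (signedExp ε y) := by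
  have hinj : ∀ ε : Fin n → ℤˣ, Set.InjOn (signedExp ε) Set.univ :=
    fun ε y _ y' _ hy => (signedExp_injective hy).2
  have hder : ∀ ε : Fin n → ℤˣ, ∀ y ∈ Set.univ, HasFDerivWithinAt (signedExp ε)
      (LinearMap.toContinuousLinearMap (Matrix.toLin' (Matrix.diagonal (signedExp ε y))))
      Set.univ y := fun ε y _ => (hasFDerivAt_signedExp ε y).hasFDerivWithinAt
  have himg : ∀ ε : Fin n → ℤˣ, ∫⁻ x in Set.range (signedExp ε), h x =
      ∫⁻ y : Fin n → ℝ, ENNReal.ofReal (Real.exp (∑ j, y j)) * h (signedExp ε y) := by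
    intro ε
    rw [← Set.image_univ, lintegral_image_eq_lintegral_abs_det_fderiv_mul volume
      MeasurableSet.univ (hder ε) (hinj ε), Measure.restrict_univ]
    refine lintegral_congr fun y => ?_
    congr 2
    rw [ContinuousLinearMap.det, LinearMap.coe_toContinuousLinearMap, LinearMap.det_toLin',
      Matrix.det_diagonal, Finset.abs_prod, Real.exp_sum]
    refine Finset.prod_congr rfl fun j _ => ?_
    rw [signedExp, abs_mul, abs_units_int_cast, one_mul, Real.abs_exp]
  have hmeas : ∀ ε : Fin n → ℤˣ, MeasurableSet (Set.range (signedExp ε)) := by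
    intro ε
    rw [← Set.image_univ]
    exact measurable_image_of_fderivWithin MeasurableSet.univ (hder ε) (hinj ε)
  have hdisj : Pairwise (Function.onFun Disjoint
      fun ε : Fin n → ℤˣ => Set.range (signedExp ε)) := by
    intro ε ε' hne
    rw [Function.onFun, Set.disjoint_left]
    rintro _ ⟨y, rfl⟩ ⟨y', hy⟩
    exact hne (signedExp_injective hy).1.symm
  have hae : (⋃ ε : Fin n → ℤˣ, Set.range (signedExp ε)) =ᵐ[volume] Set.univ := by
    rw [iUnion_range_signedExp, eventuallyEq_univ]
    exact ae_all_iff.2 fun j => Measure.ae_eval_ne (μ := fun _ : Fin n => (volume : Measure ℝ)) j 0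
  rw [← setLIntegral_univ, ← setLIntegral_congr hae, lintegral_iUnion hmeas hdisj, tsum_fintype]
  exact Finset.sum_congr rfl fun ε _ => himg ε

theorem measurePreserving_mulVec_of_mul_transpose_eq_one {C : Matrix (Fin n) (Fin n) ℝ}
    (hC : C * Cᵀ = 1) :
    MeasurePreserving (fun x : Fin n → ℝ => Cᵀ *ᵥ x) volume volume := by
  have hdet : C.det * C.det = 1 := by
    have := congrArg Matrix.det hC
    rwa [Matrix.det_mul, Matrix.det_transpose, Matrix.det_one] at this
  have habs : |C.det| = 1 := by
    rcases mul_self_eq_one_iff.1 hdet with h | h <;> simp [h]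
  have hne : Cᵀ.det ≠ 0 := by
    rw [Matrix.det_transpose]; intro h; simp [h] at hdet
  refine ⟨(Continuous.matrix_mulVec continuous_const continuous_id).measurable, ?_⟩
  have := Real.map_matrix_volume_pi_eq_smul_volume_pi hne
  rw [Matrix.det_transpose, abs_inv, habs] at this
  rw [inv_one, ENNReal.ofReal_one, one_smul] at this
  exact this

/-- Logarithmic coordinates on the orthants of the orthonormal basis formed by the rows of `C`. -/
noncomputable def logCoord (C : Matrix (Fin n) (Fin n) ℝ) (ε : Fin n → ℤˣ)
    (y : EuclideanSpace ℝ (Fin n)) : Fin n → ℝ :=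
  Cᵀ *ᵥ signedExp ε (fun j => y j)

theorem continuous_logCoord (C : Matrix (Fin n) (Fin n) ℝ) (ε : Fin n → ℤˣ) :
    Continuous (logCoord C ε) := by
  refine Continuous.matrix_mulVec continuous_const ?_
  unfold signedExp
  fun_prop

variable {C : Matrix (Fin n) (Fin n) ℝ}

theorem lintegral_eq_sum_logCoord (hC : C * Cᵀ = 1) {h : (Fin n → ℝ) → ℝ≥0∞} (hh : Measurable h) :
    ∫⁻ x, h x = ∑ ε : Fin n → ℤˣ, ∫⁻ y : EuclideanSpace ℝ (Fin n),
      ENNReal.ofReal (Real.exp (∑ j, y j)) * h (logCoord C ε y) := by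
  rw [← (measurePreserving_mulVec_of_mul_transpose_eq_one hC).lintegral_comp hh,
    lintegral_eq_sum_signedExp]
  refine Finset.sum_congr rfl fun ε _ => ?_
  have hm : Measurable fun y : Fin n → ℝ =>
      ENNReal.ofReal (Real.exp (∑ j, y j)) * h (Cᵀ *ᵥ signedExp ε y) := by
    refine Measurable.mul (by fun_prop) (hh.comp (Continuous.measurable ?_))
    refine Continuous.matrix_mulVec continuous_const ?_
    unfold signedExp
    fun_prop
  rw [← (PiLp.volume_preserving_ofLp (Fin n)).lintegral_comp hm]
  rfl

theorem ae_logCoord (hC : C * Cᵀ = 1) {p : (Fin n → ℝ) → Prop} (hp : ∀ᵐ x, p x)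
    (ε : Fin n → ℤˣ) : ∀ᵐ y, p (logCoord C ε y) := by
  set N := toMeasurable volume {x | ¬ p x} with hN
  have hNm : MeasurableSet N := measurableSet_toMeasurable _ _
  have hN0 : volume N = 0 := by rw [hN, measure_toMeasurable]; exact hp
  have h1 := lintegral_eq_sum_logCoord hC (h := N.indicator 1) (measurable_one.indicator hNm)
  rw [lintegral_indicator_one hNm, hN0, eq_comm, Finset.sum_eq_zero_iff] at h1
  have hm : Measurable fun y : EuclideanSpace ℝ (Fin n) => ENNReal.ofReal (Real.exp (∑ j, y j)) *
      N.indicator (1 : (Fin n → ℝ) → ℝ≥0∞) (logCoord C ε y) :=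
    Measurable.mul (by fun_prop)
      ((measurable_one.indicator hNm).comp (continuous_logCoord C ε).measurable)
  have h2 := (lintegral_eq_zero_iff hm).1 (h1 ε (Finset.mem_univ _))
  filter_upwards [h2] with y hy
  by_contra hcon
  have hmem : logCoord C ε y ∈ N := subset_toMeasurable _ _ hcon
  simp [Set.indicator_of_mem hmem] at hy
  exact (Real.exp_pos _).not_ge hy

/-- The function `f` on the orthant with signs `ε`, in logarithmic coordinates, normalized so that
`L²` norms are preserved. -/
noncomputable def logPull (C : Matrix (Fin n) (Fin n) ℝ) (ε : Fin n → ℤˣ) (f : (Fin n → ℝ) → ℂ)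
    (y : EuclideanSpace ℝ (Fin n)) : ℂ :=
  (Real.exp ((∑ j, y j) / 2) : ℂ) * f (logCoord C ε y)

theorem stronglyMeasurable_logPull {f : (Fin n → ℝ) → ℂ} (hf : StronglyMeasurable f)
    (ε : Fin n → ℤˣ) : StronglyMeasurable (logPull C ε f) := by
  refine StronglyMeasurable.mul (Continuous.stronglyMeasurable (by fun_prop)) ?_
  exact hf.comp_measurable (continuous_logCoord C ε).measurable

theorem eLpNorm_two_sq {X : Type*} [MeasurableSpace X] (m : Measure X) (f : X → ℂ) :
    eLpNorm f 2 m ^ 2 = ∫⁻ x, ‖f x‖ₑ ^ 2 ∂m := by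
  rw [eLpNorm_eq_lintegral_rpow_enorm_toReal (by norm_num) (by norm_num),
    ← ENNReal.rpow_natCast, ← ENNReal.rpow_mul]
  simp

theorem eLpNorm_sq_eq_sum_logPull (hC : C * Cᵀ = 1) {f : (Fin n → ℝ) → ℂ}
    (hf : StronglyMeasurable f) :
    eLpNorm f 2 volume ^ 2 = ∑ ε : Fin n → ℤˣ, eLpNorm (logPull C ε f) 2 volume ^ 2 := by
  simp only [eLpNorm_two_sq]
  rw [lintegral_eq_sum_logCoord hC (hf.measurable.enorm.pow_const 2)]
  refine Finset.sum_congr rfl fun ε _ => lintegral_congr fun y => ?_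
  rw [logPull, enorm_mul, mul_pow]
  congr 1
  rw [← ofReal_norm, Complex.norm_real, Real.norm_of_nonneg (Real.exp_pos _).le,
    ← ENNReal.ofReal_pow (Real.exp_pos _).le, ← Real.exp_nat_mul]
  congr 2; push_cast; ring

theorem eLpNorm_logPull_le (hC : C * Cᵀ = 1) {f : (Fin n → ℝ) → ℂ}
    (hf : StronglyMeasurable f) (ε : Fin n → ℤˣ) :
    eLpNorm (logPull C ε f) 2 volume ≤ eLpNorm f 2 volume := by
  rw [← ENNReal.pow_le_pow_left_iff two_ne_zero, eLpNorm_sq_eq_sum_logPull hC hf]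
  exact Finset.single_le_sum (f := fun ε => eLpNorm (logPull C ε f) 2 volume ^ 2)
    (fun _ _ => zero_le) (Finset.mem_univ ε)

theorem mulVec_logCoord (hC : C * Cᵀ = 1) (ε : Fin n → ℤˣ) (y : EuclideanSpace ℝ (Fin n)) :
    C *ᵥ logCoord C ε y = signedExp ε (fun j => y j) := by
  rw [logCoord, Matrix.mulVec_mulVec, hC, Matrix.one_mulVec]

theorem conj_diagonal_mulVec_logCoord (hC : C * Cᵀ = 1) {d : Fin n → ℝ} (hd : ∀ j, 0 < d j)
    (ε : Fin n → ℤˣ) (y : EuclideanSpace ℝ (Fin n)) :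
    (C⁻¹ * Matrix.diagonal d * C) *ᵥ logCoord C ε y =
      logCoord C ε (WithLp.toLp 2 (fun j => Real.log (d j)) + y) := by
  rw [← Matrix.mulVec_mulVec, mulVec_logCoord hC, ← Matrix.mulVec_mulVec,
    Matrix.inv_eq_right_inv hC, logCoord]
  congr 1
  ext j
  simp only [Matrix.mulVec_diagonal, signedExp, PiLp.add_apply, Real.exp_add, Real.exp_log (hd j)]
  ring

theorem exists_logPull_eq (hC : C * Cᵀ = 1) {g : EuclideanSpace ℝ (Fin n) → ℂ}
    (hg : StronglyMeasurable g) :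
    ∃ f : (Fin n → ℝ) → ℂ, StronglyMeasurable f ∧ logPull C 1 f = g ∧
      ∀ ε ≠ 1, logPull C ε f = 0 := by
  have hCm : Measurable fun x : Fin n → ℝ => C *ᵥ x :=
    (Continuous.matrix_mulVec continuous_const continuous_id).measurable
  have hCj : ∀ j, Measurable fun x : Fin n → ℝ => (C *ᵥ x) j :=
    fun j => (measurable_pi_apply j).comp hCm
  refine ⟨Set.indicator {x | ∀ j, 0 < (C *ᵥ x) j} fun x =>
    (Real.exp (-(∑ j, Real.log ((C *ᵥ x) j)) / 2) : ℂ) *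
      g (WithLp.toLp 2 fun j => Real.log ((C *ᵥ x) j)), ?_, ?_, ?_⟩
  · refine StronglyMeasurable.indicator (StronglyMeasurable.mul ?_ ?_) ?_
    · refine Measurable.stronglyMeasurable ?_
      fun_prop
    · refine hg.comp_measurable ?_
      refine (PiLp.continuous_toLp 2 _).measurable.comp ?_
      exact measurable_pi_lambda _ fun j => (hCj j).log
    · simp only [Set.ofPred_forall]
      exact MeasurableSet.iInter fun j => measurableSet_lt measurable_const (hCj j)
  · ext y
    rw [logPull, Set.indicator_of_mem]
    · simp only [mulVec_logCoord hC]
      simp only [signedExp, Pi.one_apply, Units.val_one, Int.cast_one, one_mul, Real.log_exp]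
      rw [← mul_assoc, ← Complex.ofReal_mul, ← Real.exp_add, neg_div, add_neg_cancel]
      simp
    · simp only [Set.mem_ofPred_eq, mulVec_logCoord hC]
      intro j
      simp [signedExp, Real.exp_pos]
  · intro ε hε
    ext y
    rw [logPull, Set.indicator_of_notMem, mul_zero, Pi.zero_apply]
    simp only [Set.mem_ofPred_eq, mulVec_logCoord hC]
    intro hcon
    refine hε (funext fun j => ?_)
    rcases Int.units_eq_one_or (ε j) with h | h
    · simp [h]
    · have := hcon j
      simp only [signedExp, h] at this
      have h2 := Real.exp_pos (y j)
      norm_num at this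
      linarith

end SignedExp

section Hausdorff

theorem exists_memLp_two_pos {X : Type*} [MeasurableSpace X] (m : Measure X) [SigmaFinite m] :
    ∃ G : X → ℂ, MemLp G 2 m ∧ ∀ x, G x ≠ 0 := by
  obtain ⟨g, hpos, hgm, hlt⟩ := exists_pos_lintegral_lt_of_sigmaFinite m (ε := 1) one_ne_zero
  refine ⟨fun x => (Real.sqrt (g x) : ℂ), ?_, fun x => ?_⟩
  · have hm : AEStronglyMeasurable (fun x => (Real.sqrt (g x) : ℂ)) m :=
      Measurable.aestronglyMeasurable (by fun_prop)
    rw [memLp_two_iff_integrable_sq_norm hm]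
    refine ⟨(hm.norm.pow 2), ?_⟩
    rw [hasFiniteIntegral_iff_enorm]
    refine lt_of_le_of_lt (le_of_eq (lintegral_congr fun x => ?_)) (hlt.trans ENNReal.one_lt_top)
    rw [Complex.norm_real, Real.norm_of_nonneg (Real.sqrt_nonneg _), Real.sq_sqrt (g x).coe_nonneg]
    simp
  · have := Real.sqrt_pos.2 (NNReal.coe_pos.2 (hpos x))
    show (Real.sqrt (g x) : ℂ) ≠ 0
    exact_mod_cast this.ne'

theorem exists_sub_eq_of_ne_zero {X : Type*} [MeasurableSpace X] (m : Measure X) [SigmaFinite m]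
    (f : Lp ℂ 2 m) :
    ∃ f₁ f₂ : Lp ℂ 2 m, f = f₁ - f₂ ∧ (∀ᵐ x ∂m, f₁ x ≠ 0) ∧ ∀ᵐ x ∂m, f₂ x ≠ 0 := by
  classical
  obtain ⟨G, hG, hG0⟩ := exists_memLp_two_pos m
  have hs : MeasurableSet {x | f x = 0} :=
    (Lp.stronglyMeasurable f).measurable (measurableSet_singleton 0)
  have h1 : MemLp (Set.piecewise {x | f x = 0} G ((2 : ℂ) • f)) 2 m :=
    MemLp.piecewise hs (hG.restrict _) (((Lp.memLp f).const_smul (2 : ℂ)).restrict _)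
  have h2 : MemLp (Set.piecewise {x | f x = 0} G f) 2 m :=
    MemLp.piecewise hs (hG.restrict _) ((Lp.memLp f).restrict _)
  refine ⟨h1.toLp _, h2.toLp _, ?_, ?_, ?_⟩
  · refine Lp.ext ?_
    filter_upwards [Lp.coeFn_sub (h1.toLp _) (h2.toLp _), h1.coeFn_toLp, h2.coeFn_toLp]
      with x e1 e2 e3
    rw [e1, Pi.sub_apply, e2, e3]
    by_cases hx : f x = 0
    · have hx' : x ∈ {x | f x = 0} := hx
      rw [Set.piecewise_eq_of_mem _ _ _ hx', Set.piecewise_eq_of_mem _ _ _ hx', hx, sub_self]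
    · have hx' : x ∉ {x | f x = 0} := hx
      rw [Set.piecewise_eq_of_notMem _ _ _ hx', Set.piecewise_eq_of_notMem _ _ _ hx']
      simp [two_mul]
  · filter_upwards [h1.coeFn_toLp] with x e
    rw [e]
    by_cases hx : f x = 0
    · have hx' : x ∈ {x | f x = 0} := hx
      rw [Set.piecewise_eq_of_mem _ _ _ hx']
      exact hG0 x
    · have hx' : x ∉ {x | f x = 0} := hx
      rw [Set.piecewise_eq_of_notMem _ _ _ hx']
      simpa using hx
  · filter_upwards [h2.coeFn_toLp] with x e
    rw [e]
    by_cases hx : f x = 0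
    · have hx' : x ∈ {x | f x = 0} := hx
      rw [Set.piecewise_eq_of_mem _ _ _ hx']
      exact hG0 x
    · have hx' : x ∉ {x | f x = 0} := hx
      rw [Set.piecewise_eq_of_notMem _ _ _ hx']
      exact hx

theorem ae_ae_translate {V : Type*} [AddGroup V] [MeasurableSpace V] [MeasurableAdd₂ V]
    {m : Measure V} [SFinite m] [m.IsAddLeftInvariant]
    {Ω : Type*} [MeasurableSpace Ω] {μ : Measure Ω} [SFinite μ] {l : Ω → V} (hl : Measurable l)
    {p : V → Prop} (hp : ∀ᵐ z ∂m, p z) : ∀ᵐ y ∂m, ∀ᵐ u ∂μ, p (l u + y) := by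
  set N := toMeasurable m {x | ¬ p x} with hN
  have hNm : MeasurableSet N := measurableSet_toMeasurable _ _
  have hN0 : m N = 0 := by rw [hN, measure_toMeasurable]; exact hp
  have hS : MeasurableSet {q : V × Ω | l q.2 + q.1 ∈ Nᶜ} :=
    ((hl.comp measurable_snd).add measurable_fst) hNm.compl
  have h1 : ∀ᵐ y ∂m, ∀ᵐ u ∂μ, l u + y ∈ Nᶜ := by
    rw [Measure.ae_ae_comm (p := fun y u => l u + y ∈ Nᶜ) hS]
    refine .of_forall fun u => ?_
    exact (measurePreserving_add_left m (l u)).quasiMeasurePreserving.ae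
      (measure_eq_zero_iff_ae_notMem.1 hN0)
  filter_upwards [h1] with y hy
  filter_upwards [hy] with u hu
  by_contra hcon
  exact hu (subset_toMeasurable _ _ hcon)

variable {Ω : Type*} {n : ℕ}

/-- The density of a Hausdorff operator in logarithmic coordinates. -/
noncomputable def logDensity (Φ : Ω → ℂ) (a : Fin n → Ω → ℝ) (u : Ω) : ℂ :=
  Φ u * (Real.exp (-(∑ j, Real.log (a j u)) / 2) : ℂ)

/-- The translation vectors of a Hausdorff operator in logarithmic coordinates. -/
noncomputable def logShift (a : Fin n → Ω → ℝ) (u : Ω) : EuclideanSpace ℝ (Fin n) :=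
  WithLp.toLp 2 fun j => Real.log (a j u)

theorem rpow_prod_eq_exp {d : Fin n → ℝ} (hd : ∀ j, 0 < d j) :
    (∏ j, d j) ^ (-((1 : ℝ) / 2)) = Real.exp (-(∑ j, Real.log (d j)) / 2) := by
  rw [Real.rpow_def_of_pos (Finset.prod_pos fun j _ => hd j),
    Real.log_prod (fun j _ => (hd j).ne')]
  congr 1; ring

theorem prod_cpow_eq_exp {d : Fin n → ℝ} (hd : ∀ j, 0 < d j) (s : Fin n → ℝ) :
    ∏ j, (d j : ℂ) ^ (-(1 / 2 : ℂ) - I * (s j : ℂ)) =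
      (Real.exp (-(∑ j, Real.log (d j)) / 2) : ℂ) *
        cexp (I * (inner ℝ (WithLp.toLp 2 fun j => Real.log (d j)) (WithLp.toLp 2 (-s)) : ℝ)) := by
  have h1 : ∀ j, (d j : ℂ) ^ (-(1 / 2 : ℂ) - I * (s j : ℂ)) =
      cexp ((Real.log (d j) : ℂ) * (-(1 / 2 : ℂ) - I * (s j : ℂ))) := by
    intro j
    rw [Complex.cpow_def_of_ne_zero (by exact_mod_cast (hd j).ne'), Complex.ofReal_log (hd j).le]
  simp only [h1]
  rw [← Complex.exp_sum, Complex.ofReal_exp, ← Complex.exp_add]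
  congr 1
  simp only [PiLp.inner_apply, RCLike.inner_apply, conj_trivial, Pi.neg_apply]
  push_cast
  rw [Finset.mul_sum, neg_div, Finset.sum_div, ← Finset.sum_neg_distrib, ← Finset.sum_add_distrib]
  refine Finset.sum_congr rfl fun j _ => ?_
  ring

variable [MeasurableSpace Ω] {μ : Measure Ω} {Φ : Ω → ℂ} {a : Fin n → Ω → ℝ}

theorem measurable_logShift (ha : ∀ j, Measurable (a j)) : Measurable (logShift a) :=
  (PiLp.continuous_toLp 2 _).measurable.comp
    (measurable_pi_lambda _ fun j => (ha j).log)

theorem integrable_logDensity (ha : ∀ j, Measurable (a j))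
    (hapos : ∀ᵐ u ∂μ, Φ u ≠ 0 → ∀ j, 0 < a j u)
    (hint : Integrable (fun u => ‖Φ u‖ * (∏ j, a j u) ^ (-((1 : ℝ) / 2))) μ)
    (hΦ : AEStronglyMeasurable Φ μ) : Integrable (logDensity Φ a) μ := by
  refine hint.mono (hΦ.mul (Measurable.aestronglyMeasurable (by fun_prop))) ?_
  filter_upwards [hapos] with u hu
  by_cases h0 : Φ u = 0
  · simp [logDensity, h0]
  · rw [logDensity, rpow_prod_eq_exp (hu h0), norm_mul, norm_mul, norm_norm, Complex.norm_real]

theorem symbol_eq_integral_logDensity (hapos : ∀ᵐ u ∂μ, Φ u ≠ 0 → ∀ j, 0 < a j u)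
    (s : Fin n → ℝ) :
    (fun u => Φ u * ∏ j, (a j u : ℂ) ^ (-(1 / 2 : ℂ) - I * (s j : ℂ))) =ᵐ[μ]
      fun u => logDensity Φ a u * cexp (I * (inner ℝ (logShift a u) (WithLp.toLp 2 (-s)) : ℝ)) := by
  filter_upwards [hapos] with u hu
  by_cases h0 : Φ u = 0
  · simp [logDensity, h0]
  · simp only [prod_cpow_eq_exp (hu h0), logDensity, logShift, mul_assoc]

theorem norm_symbol_integrand (hapos : ∀ᵐ u ∂μ, Φ u ≠ 0 → ∀ j, 0 < a j u) (s : Fin n → ℝ) :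
    (fun u => ‖Φ u * ∏ j, (a j u : ℂ) ^ (-(1 / 2 : ℂ) - I * (s j : ℂ))‖) =ᵐ[μ]
      fun u => ‖Φ u‖ * (∏ j, a j u) ^ (-((1 : ℝ) / 2)) := by
  filter_upwards [hapos] with u hu
  by_cases h0 : Φ u = 0
  · simp [h0]
  · rw [prod_cpow_eq_exp (hu h0), rpow_prod_eq_exp (hu h0), norm_mul, norm_mul, mul_comm I,
      Complex.norm_exp_ofReal_mul_I, mul_one, Complex.norm_real,
      Real.norm_of_nonneg (Real.exp_pos _).le]

theorem norm_symbol_le (hapos : ∀ᵐ u ∂μ, Φ u ≠ 0 → ∀ j, 0 < a j u) (s : Fin n → ℝ) :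
    ‖∫ u, Φ u * ∏ j, (a j u : ℂ) ^ (-(1 / 2 : ℂ) - I * (s j : ℂ)) ∂μ‖ ≤
      ∫ u, ‖Φ u‖ * (∏ j, a j u) ^ (-((1 : ℝ) / 2)) ∂μ :=
  (norm_integral_le_integral_norm _).trans_eq (integral_congr_ae (norm_symbol_integrand hapos s))

theorem aestronglyMeasurable_of_mul {X : Type*} [MeasurableSpace X] {m : Measure X} {f w : X → ℂ}
    (h : AEStronglyMeasurable (fun x => f x * w x) m) (hw : AEStronglyMeasurable w m)
    (hw0 : ∀ᵐ x ∂m, w x ≠ 0) : AEStronglyMeasurable f m := by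
  have hinv : AEStronglyMeasurable (fun x => (w x)⁻¹) m :=
    hw.aemeasurable.inv.aestronglyMeasurable
  refine (h.mul hinv).congr ?_
  filter_upwards [hw0] with x hx
  exact mul_inv_cancel_right₀ hx _

theorem symbol_eq_zero_of_not_aestronglyMeasurable (ha : ∀ j, Measurable (a j))
    (hapos : ∀ᵐ u ∂μ, Φ u ≠ 0 → ∀ j, 0 < a j u)
    (hΦ : ¬ AEStronglyMeasurable Φ μ) (s : Fin n → ℝ) :
    ∫ u, Φ u * ∏ j, (a j u : ℂ) ^ (-(1 / 2 : ℂ) - I * (s j : ℂ)) ∂μ = 0 := by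
  rw [integral_congr_ae (symbol_eq_integral_logDensity hapos s)]
  refine integral_non_aestronglyMeasurable fun hcon => hΦ ?_
  have hl := measurable_logShift ha
  simp only [logDensity, mul_assoc] at hcon
  refine aestronglyMeasurable_of_mul hcon (Measurable.aestronglyMeasurable (by fun_prop))
    (.of_forall fun u => ?_)
  exact mul_ne_zero (by exact_mod_cast (Real.exp_pos _).ne') (Complex.exp_ne_zero _)

variable {A : Ω → Matrix (Fin n) (Fin n) ℝ} {C : Matrix (Fin n) (Fin n) ℝ}

theorem ae_mul_comp_logCoord_eq (hC : C * Cᵀ = 1)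
    (hapos : ∀ᵐ u ∂μ, Φ u ≠ 0 → ∀ j, 0 < a j u)
    (hdiag : ∀ᵐ u ∂μ, Φ u ≠ 0 → A u = C⁻¹ * Matrix.diagonal (fun j => a j u) * C)
    (f : (Fin n → ℝ) → ℂ) (ε : Fin n → ℤˣ) (y : EuclideanSpace ℝ (Fin n)) :
    (fun u => Φ u * f ((A u).mulVec (logCoord C ε y))) =ᵐ[μ]
      fun u => Φ u * f (logCoord C ε (logShift a u + y)) := by
  filter_upwards [hapos, hdiag] with u h1 h2
  by_cases h0 : Φ u = 0
  · simp [h0]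
  · rw [h2 h0, conj_diagonal_mulVec_logCoord hC (h1 h0), logShift]

theorem ae_logPull_eq_integral (hC : C * Cᵀ = 1)
    (hapos : ∀ᵐ u ∂μ, Φ u ≠ 0 → ∀ j, 0 < a j u)
    (hdiag : ∀ᵐ u ∂μ, Φ u ≠ 0 → A u = C⁻¹ * Matrix.diagonal (fun j => a j u) * C)
    {f h : (Fin n → ℝ) → ℂ} (hfh : ∀ᵐ x, h x = ∫ u, Φ u * f ((A u).mulVec x) ∂μ)
    (ε : Fin n → ℤˣ) :
    logPull C ε h =ᵐ[volume]
      fun y => ∫ u, logDensity Φ a u * logPull C ε f (logShift a u + y) ∂μ := by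
  filter_upwards [ae_logCoord hC hfh ε] with y hy
  rw [logPull, hy, integral_congr_ae (ae_mul_comp_logCoord_eq hC hapos hdiag f ε y),
    ← integral_const_mul]
  refine integral_congr_ae (.of_forall fun u => ?_)
  have h1 : (Real.exp ((∑ j, y j) / 2) : ℂ) = (Real.exp (-(∑ j, Real.log (a j u)) / 2) : ℂ) *
      (Real.exp ((∑ j, (logShift a u + y) j) / 2) : ℂ) := by
    rw [← Complex.ofReal_mul, ← Real.exp_add]
    simp only [logShift, PiLp.add_apply, Finset.sum_add_distrib]
    congr 2; ring
  simp only [logPull, logDensity]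
  rw [h1]
  ring

variable [SigmaFinite μ]
  {T : Lp ℂ 2 (volume : Measure (Fin n → ℝ)) →L[ℂ] Lp ℂ 2 (volume : Measure (Fin n → ℝ))}

theorem hausdorff_eq_zero_of_not_aestronglyMeasurable (hC : C * Cᵀ = 1)
    (ha : ∀ j, Measurable (a j)) (hapos : ∀ᵐ u ∂μ, Φ u ≠ 0 → ∀ j, 0 < a j u)
    (hdiag : ∀ᵐ u ∂μ, Φ u ≠ 0 → A u = C⁻¹ * Matrix.diagonal (fun j => a j u) * C)
    (hT : ∀ f : Lp ℂ 2 (volume : Measure (Fin n → ℝ)),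
      ∀ᵐ x : Fin n → ℝ ∂volume, T f x = ∫ u, Φ u * f ((A u).mulVec x) ∂μ)
    (hΦ : ¬ AEStronglyMeasurable Φ μ) : T = 0 := by
  have hl := measurable_logShift ha
  have key : ∀ f : Lp ℂ 2 (volume : Measure (Fin n → ℝ)), (∀ᵐ x, f x ≠ 0) → T f = 0 := by
    intro f hf
    have hzero : ∀ ε : Fin n → ℤˣ, logPull C ε (T f) =ᵐ[volume] 0 := by
      intro ε
      filter_upwards [ae_logPull_eq_integral hC hapos hdiag (hT f) ε,
        ae_ae_translate (μ := μ) hl (ae_logCoord hC hf ε)] with y h1 h2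
      rw [h1]
      refine integral_non_aestronglyMeasurable fun hcon => hΦ ?_
      simp only [logDensity, mul_assoc] at hcon
      refine aestronglyMeasurable_of_mul hcon ?_ ?_
      · refine AEStronglyMeasurable.mul (Measurable.aestronglyMeasurable (by fun_prop)) ?_
        exact ((stronglyMeasurable_logPull (Lp.stronglyMeasurable f) ε).comp_measurable
          (hl.add_const y)).aestronglyMeasurable
      · filter_upwards [h2] with u hu
        refine mul_ne_zero (by exact_mod_cast (Real.exp_pos _).ne') (mul_ne_zero ?_ hu)
        exact_mod_cast (Real.exp_pos _).ne'
    have h3 := eLpNorm_sq_eq_sum_logPull hC (Lp.stronglyMeasurable (T f))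
    rw [Finset.sum_eq_zero fun ε _ => by
      rw [eLpNorm_congr_ae (hzero ε), eLpNorm_zero, zero_pow two_ne_zero]] at h3
    rw [Lp.eq_zero_iff_ae_eq_zero, ← eLpNorm_eq_zero_iff (Lp.aestronglyMeasurable _) two_ne_zero]
    exact pow_eq_zero_iff two_ne_zero |>.1 h3
  ext1 f
  obtain ⟨f₁, f₂, rfl, h1, h2⟩ := exists_sub_eq_of_ne_zero volume f
  rw [map_sub, key f₁ h1, key f₂ h2, sub_self, _root_.zero_apply]

theorem opNorm_hausdorff_le (hC : C * Cᵀ = 1)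
    (ha : ∀ j, Measurable (a j)) (hapos : ∀ᵐ u ∂μ, Φ u ≠ 0 → ∀ j, 0 < a j u)
    (hdiag : ∀ᵐ u ∂μ, Φ u ≠ 0 → A u = C⁻¹ * Matrix.diagonal (fun j => a j u) * C)
    (hT : ∀ f : Lp ℂ 2 (volume : Measure (Fin n → ℝ)),
      ∀ᵐ x : Fin n → ℝ ∂volume, T f x = ∫ u, Φ u * f ((A u).mulVec x) ∂μ)
    (hψ : Integrable (logDensity Φ a) μ) {M : ℝ}
    (hM : ∀ s, ‖∫ u, logDensity Φ a u * cexp (I * (inner ℝ (logShift a u) s : ℝ)) ∂μ‖ ≤ M) :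
    ‖T‖ ≤ M := by
  have hM0 : 0 ≤ M := (norm_nonneg _).trans (hM 0)
  refine ContinuousLinearMap.opNorm_le_bound _ hM0 fun f => ?_
  have hpull : ∀ (f : Lp ℂ 2 (volume : Measure (Fin n → ℝ))) (ε : Fin n → ℤˣ),
      MemLp (logPull C ε f) 2 := fun f ε =>
    ⟨(stronglyMeasurable_logPull (Lp.stronglyMeasurable f) ε).aestronglyMeasurable,
      (eLpNorm_logPull_le hC (Lp.stronglyMeasurable f) ε).trans_lt (Lp.memLp f).2⟩
  have horth : ∀ ε : Fin n → ℤˣ, eLpNorm (logPull C ε (T f)) 2 volume ≤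
      ENNReal.ofReal M * eLpNorm (logPull C ε f) 2 volume := by
    intro ε
    have h1 := ae_logPull_eq_integral hC hapos hdiag (hT f) ε
    rw [eLpNorm_congr_ae h1]
    exact eLpNorm_integral_translate_le hψ (measurable_logShift ha) hM
      (stronglyMeasurable_logPull (Lp.stronglyMeasurable f) ε) (hpull f ε)
      ((memLp_congr_ae h1).1 (hpull (T f) ε))
  have hle : eLpNorm (T f) 2 volume ≤ ENNReal.ofReal M * eLpNorm f 2 volume := by
    rw [← ENNReal.pow_le_pow_left_iff two_ne_zero, mul_pow,
      eLpNorm_sq_eq_sum_logPull hC (Lp.stronglyMeasurable (T f)),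
      eLpNorm_sq_eq_sum_logPull hC (Lp.stronglyMeasurable f), Finset.mul_sum]
    refine Finset.sum_le_sum fun ε _ => ?_
    rw [← mul_pow]
    exact pow_le_pow_left' (horth ε) 2
  rw [Lp.norm_def, Lp.norm_def, ← ENNReal.toReal_ofReal hM0, ← ENNReal.toReal_mul]
  exact ENNReal.toReal_mono
    (ENNReal.mul_ne_top ENNReal.ofReal_ne_top (Lp.memLp f).eLpNorm_ne_top) hle

theorem norm_symbol_le_opNorm_hausdorff (hC : C * Cᵀ = 1)
    (ha : ∀ j, Measurable (a j)) (hapos : ∀ᵐ u ∂μ, Φ u ≠ 0 → ∀ j, 0 < a j u)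
    (hdiag : ∀ᵐ u ∂μ, Φ u ≠ 0 → A u = C⁻¹ * Matrix.diagonal (fun j => a j u) * C)
    (hT : ∀ f : Lp ℂ 2 (volume : Measure (Fin n → ℝ)),
      ∀ᵐ x : Fin n → ℝ ∂volume, T f x = ∫ u, Φ u * f ((A u).mulVec x) ∂μ)
    (hψ : Integrable (logDensity Φ a) μ) (s : EuclideanSpace ℝ (Fin n)) :
    ‖∫ u, logDensity Φ a u * cexp (I * (inner ℝ (logShift a u) s : ℝ)) ∂μ‖ ≤ ‖T‖ := by
  have hl := measurable_logShift ha
  refine norm_integral_mul_cexp_le hψ hl (norm_nonneg T) (fun g hgm hg => ?_) s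
  obtain ⟨f, hfm, hf1, hfε⟩ := exists_logPull_eq hC hgm
  have hnorm : eLpNorm f 2 volume = eLpNorm g 2 volume := by
    refine (ENNReal.pow_right_strictMono two_ne_zero).injective ?_
    rw [eLpNorm_sq_eq_sum_logPull hC hfm,
      Finset.sum_eq_single 1 (fun ε _ hε => by simp [hfε ε hε]) (by simp), hf1]
  have hf : MemLp f 2 := ⟨hfm.aestronglyMeasurable, by rw [hnorm]; exact hg.2⟩
  set F := hf.toLp f with hF
  have hpull : ∀ᵐ z, logPull C 1 F z = g z := by
    filter_upwards [ae_logCoord hC hf.coeFn_toLp 1] with z hz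
    rw [logPull, hz, ← hf1, logPull]
  have heq : logPull C 1 (T F) =ᵐ[volume]
      fun y => ∫ u, logDensity Φ a u * g (logShift a u + y) ∂μ := by
    filter_upwards [ae_logPull_eq_integral hC hapos hdiag (hT F) 1,
      ae_ae_translate (μ := μ) hl hpull] with y h1 h2
    rw [h1]
    refine integral_congr_ae ?_
    filter_upwards [h2] with u hu
    rw [hu]
  have hTle := eLpNorm_logPull_le hC (Lp.stronglyMeasurable (T F)) 1
  refine ⟨(memLp_congr_ae heq).1 ⟨(stronglyMeasurable_logPull (Lp.stronglyMeasurable (T F))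
    1).aestronglyMeasurable, hTle.trans_lt (Lp.memLp (T F)).2⟩, ?_⟩
  rw [← eLpNorm_congr_ae heq]
  refine hTle.trans ?_
  have h3 := T.le_opNorm F
  rw [← hnorm, ← eLpNorm_congr_ae hf.coeFn_toLp,
    ← ENNReal.ofReal_toReal (Lp.memLp (T F)).eLpNorm_ne_top,
    ← ENNReal.ofReal_toReal (Lp.memLp (hf.toLp f)).eLpNorm_ne_top, ← Lp.norm_def, ← Lp.norm_def,
    ← ENNReal.ofReal_mul (norm_nonneg T)]
  exact ENNReal.ofReal_le_ofReal h3

end Hausdorff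

/-- The norm of a normal Hausdorff operator on `L²(ℝⁿ)` equals `sup |φ|`, the supremum of the
modulus of its symbol; if moreover `Φ ≥ 0` a.e., it equals `∫ Φ(u) (det A(u))^{-1/2} dμ(u)`. -/
theorem hausdorff_norm {Ω : Type*} [MeasurableSpace Ω] (μ : Measure Ω)
    [SigmaFinite μ] (n : ℕ)
    (Φ : Ω → ℂ) (A : Ω → Matrix (Fin n) (Fin n) ℝ)
    (C : Matrix (Fin n) (Fin n) ℝ) (hC : C * Cᵀ = 1)
    (a : Fin n → Ω → ℝ) (ha : ∀ j, Measurable (a j))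
    (hapos : ∀ᵐ u ∂μ, Φ u ≠ 0 → ∀ j, 0 < a j u)
    (hdiag : ∀ᵐ u ∂μ, Φ u ≠ 0 → A u = C⁻¹ * Matrix.diagonal (fun j => a j u) * C)
    (hint : Integrable (fun u => ‖Φ u‖ * (∏ j, a j u) ^ (-((1 : ℝ) / 2))) μ)
    (T : Lp ℂ 2 (volume : Measure (Fin n → ℝ)) →L[ℂ] Lp ℂ 2 (volume : Measure (Fin n → ℝ)))
    (hT : ∀ f : Lp ℂ 2 (volume : Measure (Fin n → ℝ)),
      ∀ᵐ x : Fin n → ℝ ∂volume, T f x = ∫ u, Φ u * f ((A u).mulVec x) ∂μ)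
    (φ : (Fin n → ℝ) → ℂ)
    (hφ : ∀ s : Fin n → ℝ,
      φ s = ∫ u, Φ u * ∏ j, (a j u : ℂ) ^ (-(1 / 2 : ℂ) - Complex.I * (s j : ℂ)) ∂μ) :
    (‖T‖ = ⨆ s : Fin n → ℝ, ‖φ s‖) ∧
    ((∀ᵐ u ∂μ, ∃ r : ℝ, 0 ≤ r ∧ Φ u = (r : ℂ)) →
      ‖T‖ = ∫ u, (Φ u).re * (∏ j, a j u) ^ (-((1 : ℝ) / 2)) ∂μ) := by
  have hbdd : BddAbove (Set.range fun s => ‖φ s‖) := by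
    refine ⟨∫ u, ‖Φ u‖ * (∏ j, a j u) ^ (-((1 : ℝ) / 2)) ∂μ, ?_⟩
    rintro _ ⟨s, rfl⟩
    simp only [hφ]
    exact norm_symbol_le hapos s
  have hnorm : ‖T‖ = ⨆ s : Fin n → ℝ, ‖φ s‖ := by
    by_cases hΦ : AEStronglyMeasurable Φ μ
    · have hψ := integrable_logDensity ha hapos hint hΦ
      have hsym : ∀ s : Fin n → ℝ, φ s = ∫ u, logDensity Φ a u *
          cexp (I * (inner ℝ (logShift a u) (WithLp.toLp 2 (-s)) : ℝ)) ∂μ := fun s => by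
        rw [hφ, integral_congr_ae (symbol_eq_integral_logDensity hapos s)]
      refine le_antisymm (opNorm_hausdorff_le hC ha hapos hdiag hT hψ fun s => ?_)
        (ciSup_le fun s => ?_)
      · have := le_ciSup hbdd (-(WithLp.ofLp s))
        simpa only [hsym, neg_neg, WithLp.toLp_ofLp] using this
      · rw [hsym]
        exact norm_symbol_le_opNorm_hausdorff hC ha hapos hdiag hT hψ _
    · have hφ0 : ∀ s, φ s = 0 := fun s => by
        rw [hφ, symbol_eq_zero_of_not_aestronglyMeasurable ha hapos hΦ s]
      rw [hausdorff_eq_zero_of_not_aestronglyMeasurable hC ha hapos hdiag hT hΦ]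
      simp [hφ0]
  refine ⟨hnorm, fun hpos => ?_⟩
  have hre : ∫ u, ‖Φ u‖ * (∏ j, a j u) ^ (-((1 : ℝ) / 2)) ∂μ =
      ∫ u, (Φ u).re * (∏ j, a j u) ^ (-((1 : ℝ) / 2)) ∂μ := by
    refine integral_congr_ae ?_
    filter_upwards [hpos] with u hu
    obtain ⟨r, hr, h⟩ := hu
    simp only [h, Complex.norm_real, Real.norm_of_nonneg hr, Complex.ofReal_re]
  have hφ0 : φ 0 = ((∫ u, (Φ u).re * (∏ j, a j u) ^ (-((1 : ℝ) / 2)) ∂μ : ℝ) : ℂ) := by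
    rw [hφ, ← integral_complex_ofReal]
    refine integral_congr_ae ?_
    filter_upwards [hpos, hapos] with u hu hau
    obtain ⟨r, hr, h⟩ := hu
    by_cases h0 : Φ u = 0
    · simp [h0]
    · rw [prod_cpow_eq_exp (hau h0), rpow_prod_eq_exp (hau h0), h]
      simp
  rw [hnorm]
  refine le_antisymm (ciSup_le fun s => ?_) ?_
  · rw [hφ, ← hre]
    exact norm_symbol_le hapos s
  · refine le_trans ?_ (le_ciSup hbdd 0)
    rw [hφ0, Complex.norm_real]
    exact le_abs_self _
end

section
/- Let H_{Φ,A} and H_{Ψ,B} be Hausdorff operators over the same measure space (Ω, μ) such that all matrices A(u) (u in the support of Φ) and B(v) (v in the support of Ψ) form one pairwise commuting family of real symmetric positive definite n×n matrices, with u ↦ |Φ(u)|(det A(u))^{-1/2} and v ↦ |Ψ(v)|(det B(v))^{-1/2} μ-integrable. Let T_Φ and T_Ψ be continuous linear operators on L²(ℝⁿ;ℂ) realizing H_{Φ,A} and H_{Ψ,B}, with symbols φ and ψ. Then T_Ψ is a two-sided inverse of T_Φ (T_Φ ∘ T_Ψ = T_Ψ ∘ T_Φ = Id) if and only if φ(s)·ψ(s)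 = 1 for all s ∈ ℝⁿ. -/
open MeasureTheory Complex Filter Matrix
open scoped ENNReal ComplexConjugate

/-- A finite real measure, given by a density, whose Fourier transform is a constant `c ≥ 0`
is the point mass `c • δ₀`, in the sense that it integrates functions like that point mass. -/
theorem integral_ofReal_mul_comp_eq_of_fourier_const {X E : Type*} [MeasurableSpace X]
    [NormedAddCommGroup E] [NormedSpace ℝ E] [MeasurableSpace E] [BorelSpace E]
    [SecondCountableTopology E] [CompleteSpace E]
    {m : Measure X} {r : X → ℝ} (hr : Integrable r m) (c : NNReal) {ℓ : X → E}
    (hℓ : Measurable ℓ)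
    (h : ∀ L : StrongDual ℝ E, ∫ x, (r x : ℂ) * exp (L (ℓ x) * I) ∂m = (c : ℝ))
    {F : E → ℂ} (hF : StronglyMeasurable F) (hi : Integrable (fun x => (r x : ℂ) * F (ℓ x)) m) :
    ∫ x, (r x : ℂ) * F (ℓ x) ∂m = (c : ℝ) * F 0 := by
  let p : X → NNReal := fun x => (r x).toNNReal
  let q : X → NNReal := fun x => (-r x).toNNReal
  have hp : AEMeasurable p m := hr.aemeasurable.real_toNNReal
  have hq : AEMeasurable q m := hr.aemeasurable.neg.real_toNNReal
  have hpq : ∀ x, (r x : ℂ) = ((p x : ℝ) : ℂ) - ((q x : ℝ) : ℂ) := fun x => by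
    rw [← ofReal_sub]
    congr 1
    simp only [p, q, Real.coe_toNNReal']
    rcases le_total (r x) 0 with h0 | h0
    · rw [max_eq_right h0, max_eq_left (by linarith)]; ring
    · rw [max_eq_left h0, max_eq_right (by linarith)]; ring
  have hple : ∀ x, (p x : ℝ) ≤ |r x| := fun x => by
    simp only [p, Real.coe_toNNReal']
    exact max_le (le_abs_self _) (abs_nonneg _)
  have hqle : ∀ x, (q x : ℝ) ≤ |r x| := fun x => by
    simp only [q, Real.coe_toNNReal']
    exact max_le (neg_le_abs _) (abs_nonneg _)
  have hdom : ∀ k : X → NNReal, AEMeasurable k m → (∀ x, (k x : ℝ) ≤ |r x|) → ∀ G : E → ℂ,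
      StronglyMeasurable G → Integrable (fun x => (r x : ℂ) * G (ℓ x)) m →
      Integrable (fun x => k x • G (ℓ x)) m := fun k hk hkr G hG hGi => by
    refine hGi.mono (hk.aestronglyMeasurable.smul
      (hG.comp_measurable hℓ).aestronglyMeasurable) (Eventually.of_forall fun x => ?_)
    rw [NNReal.smul_def, norm_smul, norm_mul, NNReal.norm_eq, norm_real, Real.norm_eq_abs]
    exact mul_le_mul_of_nonneg_right (hkr x) (norm_nonneg _)
  have hmap : ∀ k : X → NNReal, AEMeasurable k m → ∀ G : E → ℂ, StronglyMeasurable G →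
      ∫ y, G y ∂((m.withDensity fun x => k x).map ℓ) = ∫ x, k x • G (ℓ x) ∂m :=
    fun k hk G hG => by
      rw [integral_map hℓ.aemeasurable hG.aestronglyMeasurable,
        integral_withDensity_eq_integral_smul₀ hk]
  have hfin : ∀ k : X → NNReal, AEMeasurable k m → (∀ x, (k x : ℝ) ≤ |r x|) →
      IsFiniteMeasure ((m.withDensity fun x => k x).map ℓ) := fun k hk hkr => by
    have : IsFiniteMeasure (m.withDensity fun x => (k x : ℝ≥0∞)) := by
      refine isFiniteMeasure_withDensity (ne_of_lt ?_)
      refine lt_of_le_of_lt (lintegral_mono fun x => ?_) hr.2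
      rw [enorm_eq_nnnorm, ENNReal.coe_le_coe, ← NNReal.coe_le_coe]
      simpa using hkr x
    infer_instance
  have hPfin := hfin p hp hple
  have hNfin := hfin q hq hqle
  have hchar : ∀ L : StrongDual ℝ E, StronglyMeasurable fun y : E => exp (L y * I) := fun L =>
    Continuous.stronglyMeasurable (by fun_prop)
  have hchari : ∀ L : StrongDual ℝ E, Integrable (fun x => (r x : ℂ) * exp (L (ℓ x) * I)) m :=
    fun L => by
      refine (hr.ofReal (𝕜 := ℂ)).mono (hr.ofReal.aestronglyMeasurable.mul
        ((hchar L).comp_measurable hℓ).aestronglyMeasurable) (Eventually.of_forall fun x => ?_)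
      rw [norm_mul, norm_exp_ofReal_mul_I, mul_one]
      exact le_rfl
  have hsplit : ∀ G : E → ℂ, StronglyMeasurable G → Integrable (fun x => (r x : ℂ) * G (ℓ x)) m →
      ∫ x, (r x : ℂ) * G (ℓ x) ∂m = ∫ y, G y ∂((m.withDensity fun x => p x).map ℓ)
        - ∫ y, G y ∂((m.withDensity fun x => q x).map ℓ) := fun G hG hGi => by
    rw [hmap p hp G hG, hmap q hq G hG,
      ← integral_sub (hdom p hp hple G hG hGi) (hdom q hq hqle G hG hGi)]
    refine integral_congr_ae (Eventually.of_forall fun x => ?_)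
    simp only [hpq, NNReal.smul_def, real_smul]
    ring
  have key : (m.withDensity fun x => p x).map ℓ
      = (m.withDensity fun x => q x).map ℓ + c • Measure.dirac 0 := by
    refine Measure.ext_of_charFunDual (funext fun L => ?_)
    have hadd : charFunDual ((m.withDensity fun x => (q x : ℝ≥0∞)).map ℓ + c • Measure.dirac 0) L
        = charFunDual ((m.withDensity fun x => (q x : ℝ≥0∞)).map ℓ) L + (c : ℝ) := by
      simp only [charFunDual_apply]
      rw [integral_add_measure, integral_smul_nnreal_measure, integral_dirac]
      · simp [NNReal.smul_def]
      · rw [integrable_map_measure (hchar L).aestronglyMeasurable hℓ.aemeasurable,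
          integrable_withDensity_iff_integrable_smul₀ hq]
        exact hdom q hq hqle _ (hchar L) (hchari L)
      · refine Integrable.mono' (integrable_const (1 : ℝ)) (hchar L).aestronglyMeasurable ?_
        exact Eventually.of_forall fun x => by rw [norm_exp_ofReal_mul_I]
    rw [hadd]
    have := hsplit _ (hchar L) (hchari L)
    rw [h L] at this
    simp only [charFunDual_apply]
    rw [this]
    ring
  rw [hsplit F hF hi, key, integral_add_measure, integral_smul_nnreal_measure, integral_dirac]
  · simp [NNReal.smul_def]
  · rw [integrable_map_measure hF.aestronglyMeasurable hℓ.aemeasurable,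
      integrable_withDensity_iff_integrable_smul₀ hq]
    exact hdom q hq hqle F hF hi
  · exact (integrable_dirac (by simp)).smul_measure_nnreal

/-- A complex measure `k dm`, pushed forward by `ℓ`, whose Fourier transform is identically `1`
integrates functions like the Dirac mass at `0`. -/
theorem integral_mul_comp_eq_of_fourier_one {X E : Type*} [MeasurableSpace X]
    [NormedAddCommGroup E] [NormedSpace ℝ E] [MeasurableSpace E] [BorelSpace E]
    [SecondCountableTopology E] [CompleteSpace E]
    {m : Measure X} {k : X → ℂ} (hk : Integrable k m) {ℓ : X → E} (hℓ : Measurable ℓ)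
    (h : ∀ L : StrongDual ℝ E, ∫ x, k x * exp (L (ℓ x) * I) ∂m = 1)
    {F : E → ℂ} (hF : StronglyMeasurable F) (hi : Integrable (fun x => k x * F (ℓ x)) m) :
    ∫ x, k x * F (ℓ x) ∂m = F 0 := by
  have hchar : ∀ L : StrongDual ℝ E, StronglyMeasurable fun y : E => exp (L y * I) := fun L =>
    Continuous.stronglyMeasurable (by fun_prop)
  have hdom : ∀ (κ : X → ℝ), AEStronglyMeasurable κ m → (∀ x, |κ x| ≤ ‖k x‖) →
      ∀ G : E → ℂ, StronglyMeasurable G → Integrable (fun x => k x * G (ℓ x)) m →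
      Integrable (fun x => (κ x : ℂ) * G (ℓ x)) m := fun κ hκ hκk G hG hGi => by
    refine hGi.mono ((continuous_ofReal.comp_aestronglyMeasurable hκ).mul
      (hG.comp_measurable hℓ).aestronglyMeasurable) (Eventually.of_forall fun x => ?_)
    rw [norm_mul, norm_mul, norm_real, Real.norm_eq_abs]
    exact mul_le_mul_of_nonneg_right (hκk x) (norm_nonneg _)
  have hre : Integrable (fun x => (k x).re) m := hk.re
  have him : Integrable (fun x => (k x).im) m := hk.im
  have hre' := hdom _ hre.1 fun x => abs_re_le_norm (k x)
  have him' := hdom _ him.1 fun x => abs_im_le_norm (k x)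
  have hchari : ∀ L : StrongDual ℝ E, Integrable (fun x => k x * exp (L (ℓ x) * I)) m :=
    fun L => by
      refine hk.mono (hk.aestronglyMeasurable.mul
        ((hchar L).comp_measurable hℓ).aestronglyMeasurable) (Eventually.of_forall fun x => ?_)
      rw [norm_mul, norm_exp_ofReal_mul_I, mul_one]
  have hsplit : ∀ G : E → ℂ, StronglyMeasurable G → Integrable (fun x => k x * G (ℓ x)) m →
      ∫ x, k x * G (ℓ x) ∂m = ∫ x, ((k x).re : ℂ) * G (ℓ x) ∂m
        + I * ∫ x, ((k x).im : ℂ) * G (ℓ x) ∂m := fun G hG hGi => by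
    rw [← integral_const_mul, ← integral_add (hre' G hG hGi) ((him' G hG hGi).const_mul I)]
    refine integral_congr_ae (Eventually.of_forall fun x => ?_)
    dsimp only
    nth_rw 1 [← re_add_im (k x)]
    ring
  have hconj : ∀ L : StrongDual ℝ E, ∫ x, ((k x).re : ℂ) * exp (L (ℓ x) * I) ∂m
      - I * ∫ x, ((k x).im : ℂ) * exp (L (ℓ x) * I) ∂m = 1 := fun L => by
    have h1 := congrArg conj (h (-L))
    rw [← integral_conj, map_one] at h1
    rw [← h1, ← integral_const_mul, ← integral_sub (hre' _ (hchar L) (hchari L))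
      ((him' _ (hchar L) (hchari L)).const_mul I)]
    refine integral_congr_ae (Eventually.of_forall fun x => ?_)
    simp only [map_mul, ← exp_conj, _root_.neg_apply, ofReal_neg, map_neg, conj_ofReal,
      conj_I, neg_mul_neg]
    have : conj (k x) = (k x).re - (k x).im * I := by
      apply Complex.ext <;> simp
    rw [this]
    ring
  have hsum : ∀ L : StrongDual ℝ E, ∫ x, ((k x).re : ℂ) * exp (L (ℓ x) * I) ∂m
      + I * ∫ x, ((k x).im : ℂ) * exp (L (ℓ x) * I) ∂m = 1 := fun L => by
    rw [← hsplit _ (hchar L) (hchari L), h L]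
  have hR := integral_ofReal_mul_comp_eq_of_fourier_const hre 1 hℓ (fun L => by
    push_cast
    linear_combination (hsum L + hconj L) / 2) hF (hre' F hF hi)
  have hI := integral_ofReal_mul_comp_eq_of_fourier_const him 0 hℓ (fun L => by
    push_cast
    have hI2 := I_mul_I
    linear_combination -I * (hsum L - hconj L) / 2
      + (∫ x, ((k x).im : ℂ) * exp (L (ℓ x) * I) ∂m) * hI2) hF (him' F hF hi)
  rw [hsplit F hF hi, hR, hI]
  simp

/-- The matrix with eigenvalues `w` that is diagonalized by `C`. -/
noncomputable def conjDiagonal {n : ℕ} (C : Matrix (Fin n) (Fin n) ℝ) (w : Fin n → ℝ) :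
    Matrix (Fin n) (Fin n) ℝ :=
  C⁻¹ * Matrix.diagonal w * C

section ConjDiagonal

variable {n : ℕ} {C : Matrix (Fin n) (Fin n) ℝ}

theorem mulVec_conjDiagonal_mulVec (hC : IsUnit C.det) (w x : Fin n → ℝ) :
    C *ᵥ (conjDiagonal C w *ᵥ x) = w * (C *ᵥ x) := by
  rw [conjDiagonal, mulVec_mulVec, mul_assoc, mul_nonsing_inv_cancel_left _ _ hC, ← mulVec_mulVec]
  ext j
  simp [mulVec_diagonal]

theorem conjDiagonal_mul (hC : IsUnit C.det) (v w : Fin n → ℝ) :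
    conjDiagonal C v * conjDiagonal C w = conjDiagonal C (v * w) := by
  have : Matrix.diagonal (v * w) = Matrix.diagonal v * Matrix.diagonal w := by
    rw [diagonal_mul_diagonal]; rfl
  simp only [conjDiagonal, this, mul_assoc, mul_nonsing_inv_cancel_left _ _ hC]

theorem conjDiagonal_one (hC : IsUnit C.det) : conjDiagonal C 1 = 1 := by
  rw [conjDiagonal]
  simp [nonsing_inv_mul _ hC]

theorem det_conjDiagonal (hC : IsUnit C.det) (w : Fin n → ℝ) :
    (conjDiagonal C w).det = ∏ j, w j := by
  rw [conjDiagonal, det_mul, det_mul, det_diagonal, mul_right_comm, ← det_mul,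
    nonsing_inv_mul _ hC, det_one, one_mul]

theorem continuous_conjDiagonal_mulVec :
    Continuous fun p : (Fin n → ℝ) × (Fin n → ℝ) => conjDiagonal C p.1 *ᵥ p.2 := by
  unfold conjDiagonal
  fun_prop

theorem measurable_conjDiagonal_mulVec {X : Type*} [MeasurableSpace X] {w : X → Fin n → ℝ}
    (hw : Measurable w) : Measurable fun p : X × (Fin n → ℝ) => conjDiagonal C (w p.1) *ᵥ p.2 := by
  have h : Measurable fun p : X × (Fin n → ℝ) => (w p.1, p.2) :=
    (hw.comp measurable_fst).prodMk measurable_snd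
  have h' := (continuous_conjDiagonal_mulVec (C := C)).measurable
  exact Measurable.comp (f := fun p : X × (Fin n → ℝ) => (w p.1, p.2))
    (g := fun p : (Fin n → ℝ) × (Fin n → ℝ) => conjDiagonal C p.1 *ᵥ p.2) h' h

theorem measurable_conjDiagonal_mulVec_left {X : Type*} [MeasurableSpace X] {w : X → Fin n → ℝ}
    (hw : Measurable w) (x : Fin n → ℝ) : Measurable fun u => conjDiagonal C (w u) *ᵥ x := by
  have h := measurable_conjDiagonal_mulVec (C := C) hw
  exact Measurable.comp (g := fun p : X × (Fin n → ℝ) => conjDiagonal C (w p.1) *ᵥ p.2)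
    (f := fun u => (u, x)) h measurable_prodMk_right

theorem measurable_conjDiagonal_mulVec_right (w : Fin n → ℝ) :
    Measurable fun x => conjDiagonal C w *ᵥ x :=
  Continuous.measurable (by fun_prop)

theorem map_conjDiagonal_volume (hC : IsUnit C.det) {w : Fin n → ℝ} (hw : ∀ j, 0 < w j) :
    Measure.map (fun x => conjDiagonal C w *ᵥ x) volume
      = ENNReal.ofReal (∏ j, w j)⁻¹ • volume := by
  have hpos : 0 < ∏ j, w j := Finset.prod_pos fun j _ => hw j
  have := Real.map_matrix_volume_pi_eq_smul_volume_pi (M := conjDiagonal C w)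
    (by rw [det_conjDiagonal hC]; exact hpos.ne')
  rwa [det_conjDiagonal hC, abs_of_pos (inv_pos.2 hpos)] at this

/-- Functions that agree almost everywhere agree along almost every orbit of a family of
invertible matrices. -/
theorem ae_ae_comp_conjDiagonal (hC : IsUnit C.det) {X : Type*} [MeasurableSpace X]
    {m : Measure X} [SFinite m] {w : X → Fin n → ℝ} (hw : Measurable w)
    (hpos : ∀ u j, 0 < w u j) {P : (Fin n → ℝ) → Prop} (hP : ∀ᵐ x, P x) :
    ∀ᵐ x : Fin n → ℝ, ∀ᵐ u ∂m, P (conjDiagonal C (w u) *ᵥ x) := by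
  obtain ⟨S, hS, hSm, hS0⟩ := exists_measurable_superset_of_null (ae_iff.1 hP)
  suffices h : ∀ᵐ x : Fin n → ℝ, ∀ᵐ u ∂m, conjDiagonal C (w u) *ᵥ x ∉ S by
    filter_upwards [h] with x hx
    filter_upwards [hx] with u hu
    by_contra hn
    exact hu (hS hn)
  refine (Measure.ae_ae_comm (μ := m) (ν := volume)
    (p := fun u x => conjDiagonal C (w u) *ᵥ x ∉ S) ?_).1 ?_
  · exact measurable_conjDiagonal_mulVec hw hSm.compl
  · refine Eventually.of_forall fun u => ?_
    have hmeas := measurable_conjDiagonal_mulVec_right (C := C) (w u)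
    refine ae_of_ae_map hmeas.aemeasurable (p := fun y => y ∉ S) ?_
    rw [map_conjDiagonal_volume hC (hpos u)]
    exact Measure.ae_smul_measure (measure_eq_zero_iff_ae_notMem.1 hS0) _

/-- Minkowski-type integrability of the orbit averages of a square integrable function. -/
theorem ae_integrable_mul_comp_conjDiagonal (hC : IsUnit C.det) {X : Type*} [MeasurableSpace X]
    {m : Measure X} [SFinite m] {Θ : X → ℂ} (hΘ : AEStronglyMeasurable Θ m)
    {w : X → Fin n → ℝ} (hw : Measurable w) (hpos : ∀ u j, 0 < w u j)
    (hint : Integrable (fun u => ‖Θ u‖ * (∏ j, w u j) ^ (-(1 / 2 : ℝ))) m)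
    {f : (Fin n → ℝ) → ℂ} (hfm : StronglyMeasurable f) (hf : MemLp f 2 volume) :
    ∀ᵐ x : Fin n → ℝ, Integrable (fun u => Θ u * f (conjDiagonal C (w u) *ᵥ x)) m := by
  refine ae_of_forall_measure_lt_top_ae_restrict _ fun K hK hKfin => ?_
  have hf2 : ∫⁻ x, ‖f x‖ₑ ^ 2 < ∞ := by
    have h := (memLp_two_iff_integrable_sq_norm hf.1).1 hf
    have := h.2
    simpa [HasFiniteIntegral, enorm_pow] using this
  have hprodpos : ∀ u, 0 < ∏ j, w u j := fun u => Finset.prod_pos fun j _ => hpos u j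
  have horbit : ∀ u, ∫⁻ x, ‖f (conjDiagonal C (w u) *ᵥ x)‖ₑ ^ 2
      = ENNReal.ofReal (∏ j, w u j)⁻¹ * ∫⁻ x, ‖f x‖ₑ ^ 2 := fun u => by
    rw [← lintegral_map (f := fun y => ‖f y‖ₑ ^ 2) (hfm.measurable.enorm.pow_const 2)
      (measurable_conjDiagonal_mulVec_right (w u)), map_conjDiagonal_volume hC (hpos u),
      lintegral_smul_measure, smul_eq_mul]
  have hle : ∀ t : ℝ≥0∞, t ≤ 1 + t ^ 2 := fun t => by
    rcases le_total t 1 with h | h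
    · exact h.trans le_self_add
    · exact (le_self_pow₀ h two_ne_zero).trans le_add_self
  have hbound : ∀ u, ∫⁻ x in K, ‖f (conjDiagonal C (w u) *ᵥ x)‖ₑ
      ≤ ENNReal.ofReal ((∏ j, w u j) ^ (-(1 / 2 : ℝ))) * (volume K + ∫⁻ x, ‖f x‖ₑ ^ 2) := by
    intro u
    set p := ∏ j, w u j with hp
    have hp0 : 0 < p := hprodpos u
    set a := ENNReal.ofReal (p ^ (1 / 2 : ℝ)) with ha
    set b := ENNReal.ofReal (p ^ (-(1 / 2 : ℝ))) with hb
    have hba : b * a = 1 := by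
      rw [ha, hb, ← ENNReal.ofReal_mul (by positivity), ← Real.rpow_add hp0]
      norm_num
    have haa : a ^ 2 * ENNReal.ofReal p⁻¹ = 1 := by
      rw [ha, pow_two, ← ENNReal.ofReal_mul (by positivity), ← Real.rpow_add hp0,
        ← ENNReal.ofReal_mul (by positivity)]
      norm_num [hp0.ne']
    have hfD : Measurable fun x => ‖f (conjDiagonal C (w u) *ᵥ x)‖ₑ :=
      (hfm.comp_measurable (measurable_conjDiagonal_mulVec_right (w u))).measurable.enorm
    calc ∫⁻ x in K, ‖f (conjDiagonal C (w u) *ᵥ x)‖ₑ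
        ≤ ∫⁻ x in K, b * (1 + a ^ 2 * ‖f (conjDiagonal C (w u) *ᵥ x)‖ₑ ^ 2) := by
          refine lintegral_mono fun x => ?_
          calc ‖f (conjDiagonal C (w u) *ᵥ x)‖ₑ
              = b * (a * ‖f (conjDiagonal C (w u) *ᵥ x)‖ₑ) := by rw [← mul_assoc, hba, one_mul]
            _ ≤ _ := by
              rw [← mul_pow]
              exact mul_le_mul_right (hle _) _
      _ = b * (volume K + a ^ 2 * ∫⁻ x in K, ‖f (conjDiagonal C (w u) *ᵥ x)‖ₑ ^ 2) := by
          rw [lintegral_const_mul _ (by fun_prop), lintegral_add_left (by fun_prop),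
            lintegral_const_mul _ (by fun_prop)]
          simp
      _ ≤ b * (volume K + a ^ 2 * ∫⁻ x, ‖f (conjDiagonal C (w u) *ᵥ x)‖ₑ ^ 2) := by
          gcongr
          exact Measure.restrict_le_self
      _ = _ := by rw [horbit u, ← mul_assoc, haa, one_mul]
  have hmeas : AEStronglyMeasurable (fun p : (Fin n → ℝ) × X =>
      Θ p.2 * f (conjDiagonal C (w p.2) *ᵥ p.1)) ((volume.restrict K).prod m) := by
    have h := (measurable_conjDiagonal_mulVec (C := C) hw).comp
      (measurable_swap (α := Fin n → ℝ) (β := X))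
    exact hΘ.comp_snd.mul (hfm.comp_measurable h).aestronglyMeasurable
  have hGint : Integrable (fun p : (Fin n → ℝ) × X =>
      Θ p.2 * f (conjDiagonal C (w p.2) *ᵥ p.1)) ((volume.restrict K).prod m) := by
    refine ⟨hmeas, ?_⟩
    rw [HasFiniteIntegral, lintegral_prod_symm _ hmeas.enorm]
    have hconst : volume K + ∫⁻ x, ‖f x‖ₑ ^ 2 ≠ ∞ := (ENNReal.add_lt_top.2 ⟨hKfin, hf2⟩).ne
    calc ∫⁻ u, ∫⁻ x in K, ‖Θ u * f (conjDiagonal C (w u) *ᵥ x)‖ₑ ∂volume ∂m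
        ≤ ∫⁻ u, ‖‖Θ u‖ * (∏ j, w u j) ^ (-(1 / 2 : ℝ))‖ₑ
            * (volume K + ∫⁻ x, ‖f x‖ₑ ^ 2) ∂m := by
          refine lintegral_mono fun u => ?_
          simp only [enorm_mul, enorm_norm]
          rw [lintegral_const_mul' _ _ enorm_ne_top, mul_assoc,
            Real.enorm_of_nonneg (Real.rpow_nonneg (hprodpos u).le _)]
          exact mul_le_mul_right (hbound u) _
      _ = (∫⁻ u, ‖‖Θ u‖ * (∏ j, w u j) ^ (-(1 / 2 : ℝ))‖ₑ ∂m)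
            * (volume K + ∫⁻ x, ‖f x‖ₑ ^ 2) := lintegral_mul_const' _ _ hconst
      _ < ∞ := ENNReal.mul_lt_top hint.2 hconst.lt_top
  exact hGint.prod_right_ae

end ConjDiagonal

/-- The character `w ↦ ∏ j, w j ^ (-1/2 - i s j)` whose average is the symbol. -/
noncomputable def mellinKernel {n : ℕ} (s w : Fin n → ℝ) : ℂ :=
  ∏ j, (w j : ℂ) ^ (-(1 / 2 : ℂ) - Complex.I * (s j : ℂ))

section MellinKernel

variable {n : ℕ}

theorem prod_rpow_neg_half_eq_exp {w : Fin n → ℝ} (hw : ∀ j, 0 < w j) :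
    (∏ j, w j) ^ (-(1 / 2 : ℝ)) = Real.exp (-(1 / 2) * ∑ j, Real.log (w j)) := by
  rw [Real.rpow_def_of_pos (Finset.prod_pos fun j _ => hw j), Real.log_prod fun j _ => (hw j).ne',
    mul_comm]

theorem mellinKernel_eq_exp (s : Fin n → ℝ) {w : Fin n → ℝ} (hw : ∀ j, 0 < w j) :
    mellinKernel s w = ((∏ j, w j) ^ (-(1 / 2 : ℝ)) : ℝ)
      * exp ((-∑ j, Real.log (w j) * s j : ℝ) * I) := by
  rw [prod_rpow_neg_half_eq_exp hw, mellinKernel, ofReal_exp, ← exp_add]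
  have : ∀ j, (w j : ℂ) ^ (-(1 / 2 : ℂ) - Complex.I * (s j : ℂ))
      = exp (Real.log (w j) * (-(1 / 2 : ℂ) - Complex.I * (s j : ℂ))) := fun j => by
    rw [cpow_def_of_ne_zero (by exact_mod_cast (hw j).ne'), ofReal_log (hw j).le]
  rw [Finset.prod_congr rfl fun j _ => this j, ← exp_sum]
  congr 1
  push_cast
  rw [Finset.mul_sum, neg_mul, Finset.sum_mul, ← sub_eq_add_neg, ← Finset.sum_sub_distrib]
  exact Finset.sum_congr rfl fun j _ => by ring

theorem norm_mellinKernel (s : Fin n → ℝ) {w : Fin n → ℝ} (hw : ∀ j, 0 < w j) :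
    ‖mellinKernel s w‖ = (∏ j, w j) ^ (-(1 / 2 : ℝ)) := by
  rw [mellinKernel_eq_exp s hw, norm_mul, norm_exp_ofReal_mul_I, mul_one, norm_real,
    Real.norm_of_nonneg (Real.rpow_nonneg (Finset.prod_nonneg fun j _ => (hw j).le) _)]

theorem mellinKernel_ne_zero (s : Fin n → ℝ) {w : Fin n → ℝ} (hw : ∀ j, 0 < w j) :
    mellinKernel s w ≠ 0 := by
  rw [← norm_ne_zero_iff, norm_mellinKernel s hw]
  exact (Real.rpow_pos_of_pos (Finset.prod_pos fun j _ => hw j) _).ne'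

theorem mellinKernel_mul (s : Fin n → ℝ) {v w : Fin n → ℝ} (hv : ∀ j, 0 ≤ v j)
    (hw : ∀ j, 0 ≤ w j) : mellinKernel s (v * w) = mellinKernel s v * mellinKernel s w := by
  simp only [mellinKernel, Pi.mul_apply, ofReal_mul, ← Finset.prod_mul_distrib]
  exact Finset.prod_congr rfl fun j _ => mul_cpow_ofReal_nonneg (hv j) (hw j) _

theorem measurable_mellinKernel (s : Fin n → ℝ) : Measurable (mellinKernel s) :=
  Finset.measurable_fun_prod _ fun j _ =>
    (measurable_ofReal.comp (measurable_pi_apply j)).pow_const _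

theorem integrable_mul_mellinKernel {X : Type*} [MeasurableSpace X] {m : Measure X} {Θ : X → ℂ}
    (hΘ : AEStronglyMeasurable Θ m) {w : X → Fin n → ℝ} (hw : Measurable w)
    (hpos : ∀ u j, 0 < w u j)
    (hint : Integrable (fun u => ‖Θ u‖ * (∏ j, w u j) ^ (-(1 / 2 : ℝ))) m) (s : Fin n → ℝ) :
    Integrable (fun u => Θ u * mellinKernel s (w u)) m := by
  refine hint.mono' (hΘ.mul ((measurable_mellinKernel s).comp hw).aestronglyMeasurable)
    (Eventually.of_forall fun u => ?_)
  rw [norm_mul, norm_mellinKernel s (hpos u)]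

/-- If the symbol is identically `1`, the Hausdorff operator acts as the identity. -/
theorem ae_integral_eq_of_symbol_eq_one {C : Matrix (Fin n) (Fin n) ℝ} (hC : IsUnit C.det)
    {X : Type*} [MeasurableSpace X] {m : Measure X} [SFinite m] {Θ : X → ℂ}
    (hΘ : AEStronglyMeasurable Θ m) {w : X → Fin n → ℝ} (hw : Measurable w)
    (hpos : ∀ u j, 0 < w u j)
    (hint : Integrable (fun u => ‖Θ u‖ * (∏ j, w u j) ^ (-(1 / 2 : ℝ))) m)
    (hsymb : ∀ s, ∫ u, Θ u * mellinKernel s (w u) ∂m = 1)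
    {f : (Fin n → ℝ) → ℂ} (hfm : StronglyMeasurable f) (hf : MemLp f 2 volume) :
    ∀ᵐ x : Fin n → ℝ, ∫ u, Θ u * f (conjDiagonal C (w u) *ᵥ x) ∂m = f x := by
  filter_upwards [ae_integrable_mul_comp_conjDiagonal hC hΘ hw hpos hint hfm hf] with x hx
  let ℓ : X → Fin n → ℝ := fun u j => Real.log (w u j)
  have hℓ : Measurable ℓ :=
    measurable_pi_lambda _ fun j => Real.measurable_log.comp ((measurable_pi_apply j).comp hw)
  let k : X → ℂ := fun u => Θ u * ((∏ j, w u j) ^ (-(1 / 2 : ℝ)) : ℝ)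
  let F : (Fin n → ℝ) → ℂ := fun t =>
    f (conjDiagonal C (fun j => Real.exp (t j)) *ᵥ x) * (Real.exp ((1 / 2) * ∑ j, t j) : ℝ)
  have hF : StronglyMeasurable F := by
    have he : Measurable fun t : Fin n → ℝ => fun j => Real.exp (t j) := by fun_prop
    have hD := hfm.comp_measurable (measurable_conjDiagonal_mulVec_left (C := C) he x)
    have hE : Measurable fun t : Fin n → ℝ => ((Real.exp ((1 / 2) * ∑ j, t j) : ℝ) : ℂ) := by
      fun_prop
    exact hD.mul hE.stronglyMeasurable
  have hkF : ∀ u, k u * F (ℓ u) = Θ u * f (conjDiagonal C (w u) *ᵥ x) := fun u => by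
    have hexp : (fun j => Real.exp (ℓ u j)) = w u := funext fun j => Real.exp_log (hpos u j)
    have h1 : (∏ j, w u j) ^ (-(1 / 2 : ℝ)) * Real.exp ((1 / 2) * ∑ j, ℓ u j) = 1 := by
      rw [prod_rpow_neg_half_eq_exp (hpos u), ← Real.exp_add]
      simp [ℓ]
    have h2 := congrArg (fun t : ℝ => (t : ℂ)) h1
    simp only [ofReal_mul, ofReal_one] at h2
    simp only [k, F, hexp]
    linear_combination Θ u * f (conjDiagonal C (w u) *ᵥ x) * h2
  have hk : Integrable k m := by
    refine hint.mono' (hΘ.mul ?_) (Eventually.of_forall fun u => ?_)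
    · refine Measurable.aestronglyMeasurable (measurable_ofReal.comp (Measurable.pow_const ?_ _))
      exact Finset.measurable_fun_prod _ fun j _ => (measurable_pi_apply j).comp hw
    · rw [norm_mul, norm_real, Real.norm_of_nonneg
        (Real.rpow_nonneg (Finset.prod_nonneg fun j _ => (hpos u j).le) _)]
  have hfourier : ∀ L : StrongDual ℝ (Fin n → ℝ), ∫ u, k u * exp (L (ℓ u) * I) ∂m = 1 := by
    intro L
    rw [← hsymb fun j => -L (Pi.single j 1)]
    refine integral_congr_ae (Eventually.of_forall fun u => ?_)
    have hL : L (ℓ u) = ∑ j, ℓ u j * L (Pi.single j 1) := by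
      have := LinearMap.pi_apply_eq_sum_univ L.toLinearMap (ℓ u)
      simpa [← Pi.single_apply, Pi.single_comm, funext_iff] using this
    simp only [k]
    rw [mellinKernel_eq_exp _ (hpos u), hL, mul_assoc]
    simp [ℓ]
  have := integral_mul_comp_eq_of_fourier_one hk hℓ hfourier hF (by simpa only [hkF] using hx)
  simp only [hkF] at this
  rw [this]
  have h1 : conjDiagonal C (fun _ => 1) = 1 := conjDiagonal_one hC
  simp [F, h1]

/-- If the Hausdorff operator acts as the identity, the symbol is identically `1`. -/
theorem symbol_eq_one_of_ae_integral_eq {C : Matrix (Fin n) (Fin n) ℝ} (hC : IsUnit C.det)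
    {X : Type*} [MeasurableSpace X] {m : Measure X} [SFinite m] {Θ : X → ℂ}
    (hΘ : AEStronglyMeasurable Θ m) {w : X → Fin n → ℝ} (hw : Measurable w)
    (hpos : ∀ u j, 0 < w u j)
    (hint : Integrable (fun u => ‖Θ u‖ * (∏ j, w u j) ^ (-(1 / 2 : ℝ))) m)
    (hid : ∀ f : (Fin n → ℝ) → ℂ, StronglyMeasurable f → MemLp f 2 volume →
      ∀ᵐ x : Fin n → ℝ, ∫ u, Θ u * f (conjDiagonal C (w u) *ᵥ x) ∂m = f x) (s : Fin n → ℝ) :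
    ∫ u, Θ u * mellinKernel s (w u) ∂m = 1 := by
  let S : ℕ → Set (Fin n → ℝ) := fun k => Set.pi Set.univ fun _ => Set.Icc ((k + 1 : ℝ)⁻¹) (k + 1)
  have hSm : ∀ k, MeasurableSet (S k) := fun k =>
    MeasurableSet.univ_pi fun _ => measurableSet_Icc
  have hSpos : ∀ k, ∀ y ∈ S k, ∀ j, 0 < y j := fun k y hy j =>
    lt_of_lt_of_le (by positivity) (hy j (Set.mem_univ j)).1
  have hSev : ∀ y : Fin n → ℝ, (∀ j, 0 < y j) → ∀ᶠ k in atTop, y ∈ S k := fun y hy => by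
    have : ∀ j, ∀ᶠ k : ℕ in atTop, y j ∈ Set.Icc ((k + 1 : ℝ)⁻¹) (k + 1) := fun j => by
      have hk : Tendsto (fun k : ℕ => (k + 1 : ℝ)) atTop atTop :=
        tendsto_atTop_add_const_right _ _ tendsto_natCast_atTop_atTop
      filter_upwards [hk.eventually_ge_atTop (y j), hk.eventually_ge_atTop (y j)⁻¹] with k h1 h2
      exact ⟨inv_le_of_inv_le₀ (hy j) h2, h1⟩
    filter_upwards [eventually_all.2 this] with k hk j _ using hk j
  let q : ℕ → (Fin n → ℝ) → ℂ := fun k => (S k).indicator (mellinKernel s)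
  have hqm : ∀ k, StronglyMeasurable (q k) := fun k =>
    ((measurable_mellinKernel s).indicator (hSm k)).stronglyMeasurable
  have hqlp : ∀ k, MemLp (q k) 2 volume := fun k => by
    have hcpt : IsCompact (S k) := isCompact_univ_pi fun _ => isCompact_Icc
    have hcont : ContinuousOn (mellinKernel s) (S k) := by
      refine continuousOn_finsetProd _ fun j _ => ?_
      refine ContinuousOn.cpow_const (by fun_prop) fun y hy => ?_
      exact Or.inl (by simpa using hSpos k y hy j)
    obtain ⟨M, hM⟩ := hcpt.exists_bound_of_continuousOn hcont
    refine (memLp_indicator_iff_restrict (hSm k)).2 ?_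
    have : IsFiniteMeasure (volume.restrict (S k)) := ⟨by simpa using hcpt.measure_lt_top⟩
    exact MemLp.of_bound (measurable_mellinKernel s).aestronglyMeasurable M
      ((ae_restrict_iff' (hSm k)).2 (Eventually.of_forall hM))
  have hCm : Measurable fun x : Fin n → ℝ => C *ᵥ x := Continuous.measurable (by fun_prop)
  have hfm : ∀ k, StronglyMeasurable fun x => q k (C *ᵥ x) := fun k =>
    (hqm k).comp_measurable hCm
  have hflp : ∀ k, MemLp (fun x => q k (C *ᵥ x)) 2 volume := fun k => by
    refine (memLp_map_measure_iff (hqm k).aestronglyMeasurable hCm.aemeasurable).1 ?_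
    have := Real.map_matrix_volume_pi_eq_smul_volume_pi (M := C) hC.ne_zero
    change MemLp (q k) 2 (Measure.map (toLin' C) volume)
    rw [this]
    exact (hqlp k).smul_measure ENNReal.ofReal_ne_top
  have hae : ∀ᵐ x : Fin n → ℝ, ∀ k, ∫ u, Θ u * q k (w u * (C *ᵥ x)) ∂m = q k (C *ᵥ x) := by
    refine ae_all_iff.2 fun k => ?_
    filter_upwards [hid _ (hfm k) (hflp k)] with x hx
    simpa only [mulVec_conjDiagonal_mulVec hC] using hx
  let U : Set (Fin n → ℝ) := {x | ∀ j, 0 < (C *ᵥ x) j}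
  have hU : IsOpen U := by
    have : U = ⋂ j, {x | 0 < (C *ᵥ x) j} := by ext; simp [U]
    rw [this]
    exact isOpen_iInter_of_finite fun j => isOpen_lt continuous_const (by fun_prop)
  have hUne : U.Nonempty := ⟨C⁻¹ *ᵥ 1, fun j => by
    rw [mulVec_mulVec, mul_nonsing_inv _ hC]; simp⟩
  obtain ⟨x, hx, hxU⟩ := (Measure.dense_of_ae hae).exists_mem_open hU hUne
  set y := C *ᵥ x with hy
  have hy0 : ∀ j, 0 < y j := hxU
  have hwy : ∀ u j, 0 < (w u * y) j := fun u j => mul_pos (hpos u j) (hy0 j)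
  have hmul : ∀ u, Θ u * mellinKernel s (w u * y)
      = Θ u * mellinKernel s (w u) * mellinKernel s y := fun u => by
    rw [mellinKernel_mul s (fun j => (hpos u j).le) fun j => (hy0 j).le, mul_assoc]
  have hi := (integrable_mul_mellinKernel hΘ hw hpos hint s).mul_const (mellinKernel s y)
  have hlim : Tendsto (fun k => ∫ u, Θ u * q k (w u * y) ∂m) atTop
      (nhds (∫ u, Θ u * mellinKernel s (w u * y) ∂m)) := by
    refine tendsto_integral_of_dominated_convergence _ (fun k => ?_) hi.norm (fun k => ?_) ?_
    · exact hΘ.mul ((hqm k).comp_measurable (hw.mul_const y)).aestronglyMeasurable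
    · refine Eventually.of_forall fun u => ?_
      rw [← hmul, norm_mul, norm_mul]
      exact mul_le_mul_of_nonneg_left (norm_indicator_le_norm_self _ _) (norm_nonneg _)
    · refine Eventually.of_forall fun u => tendsto_const_nhds.congr' ?_
      filter_upwards [hSev _ (hwy u)] with k hk
      simp only [q, Set.indicator_of_mem hk]
  have hlim' : Tendsto (fun k => q k y) atTop (nhds (mellinKernel s y)) := by
    refine tendsto_const_nhds.congr' ?_
    filter_upwards [hSev _ hy0] with k hk
    simp only [q, Set.indicator_of_mem hk]
  have heq := tendsto_nhds_unique hlim (hlim'.congr fun k => (hx k).symm)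
  simp only [hmul, integral_mul_const] at heq
  exact mul_right_cancel₀ (mellinKernel_ne_zero s hy0) (by rw [heq, one_mul])

end MellinKernel

section Hausdorff

variable {n : ℕ} {C : Matrix (Fin n) (Fin n) ℝ} {Ω : Type*} [MeasurableSpace Ω] {μ : Measure Ω}

theorem integrable_prod_weight [SFinite μ] {Φ Ψ : Ω → ℂ} {a b : Ω → Fin n → ℝ}
    (hapos : ∀ u j, 0 < a u j) (hbpos : ∀ u j, 0 < b u j)
    (hintA : Integrable (fun u => ‖Φ u‖ * (∏ j, a u j) ^ (-(1 / 2 : ℝ))) μ)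
    (hintB : Integrable (fun u => ‖Ψ u‖ * (∏ j, b u j) ^ (-(1 / 2 : ℝ))) μ) :
    Integrable (fun p : Ω × Ω => ‖Φ p.1 * Ψ p.2‖
      * (∏ j, (a p.1 * b p.2) j) ^ (-(1 / 2 : ℝ))) (μ.prod μ) := by
  refine (hintA.mul_prod hintB).congr (Eventually.of_forall fun p => ?_)
  simp only [Pi.mul_apply, norm_mul, Finset.prod_mul_distrib]
  rw [Real.mul_rpow (Finset.prod_nonneg fun j _ => (hapos _ j).le)
    (Finset.prod_nonneg fun j _ => (hbpos _ j).le)]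
  ring

/-- A composition of two Hausdorff operators diagonalized by the same matrix is the Hausdorff
operator over the product space. -/
theorem ae_comp_eq_integral_prod (hC : IsUnit C.det) [SFinite μ] {Φ Ψ : Ω → ℂ}
    (hΦ : AEStronglyMeasurable Φ μ) (hΨ : AEStronglyMeasurable Ψ μ) {a b : Ω → Fin n → ℝ}
    (ha : Measurable a) (hb : Measurable b) (hapos : ∀ u j, 0 < a u j) (hbpos : ∀ u j, 0 < b u j)
    (hintA : Integrable (fun u => ‖Φ u‖ * (∏ j, a u j) ^ (-(1 / 2 : ℝ))) μ)
    (hintB : Integrable (fun u => ‖Ψ u‖ * (∏ j, b u j) ^ (-(1 / 2 : ℝ))) μ)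
    {f g h : (Fin n → ℝ) → ℂ} (hfm : StronglyMeasurable f) (hf : MemLp f 2 volume)
    (hg : ∀ᵐ x, g x = ∫ v, Ψ v * f (conjDiagonal C (b v) *ᵥ x) ∂μ)
    (hh : ∀ᵐ x, h x = ∫ u, Φ u * g (conjDiagonal C (a u) *ᵥ x) ∂μ) :
    ∀ᵐ x, h x = ∫ p, Φ p.1 * Ψ p.2 * f (conjDiagonal C (a p.1 * b p.2) *ᵥ x) ∂(μ.prod μ) := by
  have hw : Measurable fun p : Ω × Ω => a p.1 * b p.2 :=
    (ha.comp measurable_fst).mul (hb.comp measurable_snd)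
  filter_upwards [hh, ae_ae_comp_conjDiagonal (m := μ) hC ha hapos hg,
    ae_integrable_mul_comp_conjDiagonal (m := μ.prod μ) hC (hΦ.comp_fst.mul hΨ.comp_snd) hw
      (fun p j => mul_pos (hapos _ j) (hbpos _ j))
      (integrable_prod_weight hapos hbpos hintA hintB) hfm hf] with x hx hgx hi
  rw [hx]
  refine Eq.trans ?_ (integral_prod _ hi).symm
  refine integral_congr_ae (hgx.mono fun u hu => ?_)
  dsimp only
  rw [hu, ← integral_const_mul]
  refine integral_congr_ae (Eventually.of_forall fun v => ?_)
  simp only [Pi.mul_apply]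
  rw [mulVec_mulVec, conjDiagonal_mul hC, mul_comm (b v), mul_assoc]

theorem hausdorff_comp_eq_one_iff (hC : IsUnit C.det) [SFinite μ] {Φ Ψ : Ω → ℂ}
    (hΦ : AEStronglyMeasurable Φ μ) (hΨ : AEStronglyMeasurable Ψ μ) {a b : Ω → Fin n → ℝ}
    (ha : Measurable a) (hb : Measurable b) (hapos : ∀ u j, 0 < a u j) (hbpos : ∀ u j, 0 < b u j)
    (hintA : Integrable (fun u => ‖Φ u‖ * (∏ j, a u j) ^ (-(1 / 2 : ℝ))) μ)
    (hintB : Integrable (fun u => ‖Ψ u‖ * (∏ j, b u j) ^ (-(1 / 2 : ℝ))) μ)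
    {TΦ TΨ : Lp ℂ 2 (volume : Measure (Fin n → ℝ)) →L[ℂ] Lp ℂ 2 (volume : Measure (Fin n → ℝ))}
    (hTΦ : ∀ f : Lp ℂ 2 (volume : Measure (Fin n → ℝ)),
      ∀ᵐ x, TΦ f x = ∫ u, Φ u * f (conjDiagonal C (a u) *ᵥ x) ∂μ)
    (hTΨ : ∀ f : Lp ℂ 2 (volume : Measure (Fin n → ℝ)),
      ∀ᵐ x, TΨ f x = ∫ v, Ψ v * f (conjDiagonal C (b v) *ᵥ x) ∂μ) :
    TΦ ∘L TΨ = 1 ↔ ∀ s, (∫ u, Φ u * mellinKernel s (a u) ∂μ)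
      * (∫ v, Ψ v * mellinKernel s (b v) ∂μ) = 1 := by
  have hΘ : AEStronglyMeasurable (fun p : Ω × Ω => Φ p.1 * Ψ p.2) (μ.prod μ) :=
    hΦ.comp_fst.mul hΨ.comp_snd
  have hw : Measurable fun p : Ω × Ω => a p.1 * b p.2 :=
    (ha.comp measurable_fst).mul (hb.comp measurable_snd)
  have hpos : ∀ (p : Ω × Ω) j, 0 < (a p.1 * b p.2) j := fun p j => mul_pos (hapos _ j) (hbpos _ j)
  have hint := integrable_prod_weight hapos hbpos hintA hintB
  have hsymb : ∀ s, (∫ u, Φ u * mellinKernel s (a u) ∂μ) * (∫ v, Ψ v * mellinKernel s (b v) ∂μ)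
      = ∫ p, Φ p.1 * Ψ p.2 * mellinKernel s (a p.1 * b p.2) ∂(μ.prod μ) := fun s => by
    rw [← integral_prod_mul]
    refine integral_congr_ae (Eventually.of_forall fun p => ?_)
    dsimp only
    rw [mellinKernel_mul s (fun j => (hapos _ j).le) fun j => (hbpos _ j).le]
    ring
  have hcomp : ∀ f : Lp ℂ 2 (volume : Measure (Fin n → ℝ)), ∀ᵐ x, (TΦ ∘L TΨ) f x
      = ∫ p, Φ p.1 * Ψ p.2 * f (conjDiagonal C (a p.1 * b p.2) *ᵥ x) ∂(μ.prod μ) := fun f =>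
    ae_comp_eq_integral_prod hC hΦ hΨ ha hb hapos hbpos hintA hintB (Lp.stronglyMeasurable f)
      (Lp.memLp f) (hTΨ f) (hTΦ (TΨ f))
  simp only [hsymb]
  constructor
  · intro h1
    refine symbol_eq_one_of_ae_integral_eq hC hΘ hw hpos hint fun f hfm hf => ?_
    filter_upwards [hcomp (hf.toLp f), hf.coeFn_toLp,
      ae_ae_comp_conjDiagonal (m := μ.prod μ) hC hw hpos hf.coeFn_toLp] with x hx hfx hfD
    rw [h1, one_apply_eq_self, hfx] at hx
    rw [hx]
    exact integral_congr_ae (hfD.mono fun p hp => by simp only [hp])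
  · intro hs
    ext f
    filter_upwards [hcomp f, ae_integral_eq_of_symbol_eq_one hC hΘ hw hpos hint hs
      (Lp.stronglyMeasurable f) (Lp.memLp f)] with x hx hx'
    rw [hx, hx', one_apply_eq_self]

theorem integral_mul_eq_zero_of_not_aestronglyMeasurable {Φ : Ω → ℂ}
    (hΦ : ¬ AEStronglyMeasurable Φ μ) {g : Ω → ℂ} (hg : Measurable g) (hg0 : ∀ᵐ u ∂μ, g u ≠ 0) :
    ∫ u, Φ u * g u ∂μ = 0 := by
  refine integral_non_aestronglyMeasurable fun h => hΦ ?_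
  refine (h.mul hg.inv.aestronglyMeasurable).congr (hg0.mono fun u hu => ?_)
  simp [hu]

/-- A non-measurable kernel makes the integral vanish on a nowhere vanishing function. -/
theorem exists_ne_zero_map_eq_zero_of_not_aestronglyMeasurable (hC : IsUnit C.det) [SFinite μ]
    {Φ : Ω → ℂ} (hΦ : ¬ AEStronglyMeasurable Φ μ) {a : Ω → Fin n → ℝ} (ha : Measurable a)
    (hapos : ∀ u j, 0 < a u j)
    {T : Lp ℂ 2 (volume : Measure (Fin n → ℝ)) →L[ℂ] Lp ℂ 2 (volume : Measure (Fin n → ℝ))}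
    (hT : ∀ f : Lp ℂ 2 (volume : Measure (Fin n → ℝ)),
      ∀ᵐ x, T f x = ∫ u, Φ u * f (conjDiagonal C (a u) *ᵥ x) ∂μ) :
    ∃ f, f ≠ 0 ∧ T f = 0 := by
  obtain ⟨g, hg0, hgm, hgi⟩ := exists_pos_lintegral_lt_of_sigmaFinite
    (volume : Measure (Fin n → ℝ)) one_ne_zero
  let q : (Fin n → ℝ) → ℂ := fun x => (Real.sqrt (g x) : ℝ)
  have hqm : Measurable q := by fun_prop
  have hq0 : ∀ x, q x ≠ 0 := fun x =>
    ofReal_ne_zero.2 (Real.sqrt_pos.2 (NNReal.coe_pos.2 (hg0 x))).ne'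
  have hqlp : MemLp q 2 volume := by
    refine (memLp_two_iff_integrable_sq_norm hqm.aestronglyMeasurable).2
      ⟨(hqm.norm.pow_const 2).aestronglyMeasurable, ?_⟩
    have : ∀ x, ‖‖q x‖ ^ 2‖ₑ = g x := fun x => by
      simp only [q, norm_real, Real.norm_eq_abs, sq_abs, Real.sq_sqrt (g x).coe_nonneg]
      simp [enorm_eq_nnnorm]
    simp only [HasFiniteIntegral, this]
    exact hgi.trans ENNReal.one_lt_top
  refine ⟨hqlp.toLp q, fun h => ?_, ?_⟩
  · have h0 : ∀ᵐ x : Fin n → ℝ, False := by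
      filter_upwards [hqlp.coeFn_toLp, Lp.coeFn_zero ℂ 2 volume] with x hx hx0
      rw [h, hx0] at hx
      exact hq0 x hx.symm
    obtain ⟨x, hx⟩ := h0.exists
    exact hx
  · ext
    filter_upwards [hT (hqlp.toLp q), Lp.coeFn_zero ℂ 2 volume,
      ae_ae_comp_conjDiagonal (m := μ) hC ha hapos hqlp.coeFn_toLp] with x hx hx0 hqx
    rw [hx, hx0, Pi.zero_apply, integral_congr_ae (hqx.mono fun u hu => by
      simp only [hu] : _ =ᵐ[μ] fun u => Φ u * q (conjDiagonal C (a u) *ᵥ x))]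
    exact integral_mul_eq_zero_of_not_aestronglyMeasurable hΦ
      (hqm.comp (measurable_conjDiagonal_mulVec_left ha x)) (Eventually.of_forall fun u => hq0 _)

end Hausdorff

/-- Replaces the non-positive entries of a family of eigenvalues by `1`. -/
noncomputable def positivize {n : ℕ} {Ω : Type*} (a : Fin n → Ω → ℝ) (u : Ω) (j : Fin n) : ℝ :=
  if 0 < a j u then a j u else 1

section Positivize

variable {n : ℕ} {Ω : Type*}

theorem positivize_pos (a : Fin n → Ω → ℝ) (u : Ω) (j : Fin n) : 0 < positivize a u j := by
  unfold positivize
  split_ifs with h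
  · exact h
  · exact one_pos

theorem positivize_eq {a : Fin n → Ω → ℝ} {u : Ω} (h : ∀ j, 0 < a j u) :
    positivize a u = fun j => a j u :=
  funext fun j => if_pos (h j)

theorem measurable_positivize [MeasurableSpace Ω] {a : Fin n → Ω → ℝ}
    (ha : ∀ j, Measurable (a j)) : Measurable (positivize a) :=
  measurable_pi_lambda _ fun j =>
    Measurable.ite (measurableSet_lt measurable_const (ha j)) (ha j) measurable_const

theorem mul_ae_eq_positivize [MeasurableSpace Ω] {μ : Measure Ω} {R : Type*} [MulZeroClass R]
    {Φ : Ω → ℂ} {a : Fin n → Ω → ℝ} (hapos : ∀ᵐ u ∂μ, Φ u ≠ 0 → ∀ j, 0 < a j u) {k : ℂ → R}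
    (hk : k 0 = 0) (G : (Fin n → ℝ) → R) :
    (fun u => k (Φ u) * G (fun j => a j u)) =ᵐ[μ] fun u => k (Φ u) * G (positivize a u) := by
  filter_upwards [hapos] with u hu
  by_cases h : Φ u = 0
  · simp [h, hk]
  · rw [positivize_eq (hu h)]

end Positivize

/-- A Hausdorff operator `T_Ψ` is the two-sided inverse of `T_Φ` (both normal, with matrix
families simultaneously diagonalized by the same orthogonal matrix) iff the product of their
symbols is identically `1`. -/
theorem hausdorff_inverse_iff {Ω : Type*} [MeasurableSpace Ω] (μ : Measure Ω)
    [SigmaFinite μ] (n : ℕ)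
    (Φ Ψ : Ω → ℂ) (A B : Ω → Matrix (Fin n) (Fin n) ℝ)
    (C : Matrix (Fin n) (Fin n) ℝ) (hC : C * Cᵀ = 1)
    (a b : Fin n → Ω → ℝ) (ha : ∀ j, Measurable (a j)) (hb : ∀ j, Measurable (b j))
    (hapos : ∀ᵐ u ∂μ, Φ u ≠ 0 → ∀ j, 0 < a j u)
    (hbpos : ∀ᵐ v ∂μ, Ψ v ≠ 0 → ∀ j, 0 < b j v)
    (hdiagA : ∀ᵐ u ∂μ, Φ u ≠ 0 → A u = C⁻¹ * Matrix.diagonal (fun j => a j u) * C)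
    (hdiagB : ∀ᵐ v ∂μ, Ψ v ≠ 0 → B v = C⁻¹ * Matrix.diagonal (fun j => b j v) * C)
    (hintA : Integrable (fun u => ‖Φ u‖ * (∏ j, a j u) ^ (-((1 : ℝ) / 2))) μ)
    (hintB : Integrable (fun v => ‖Ψ v‖ * (∏ j, b j v) ^ (-((1 : ℝ) / 2))) μ)
    (TΦ TΨ : Lp ℂ 2 (volume : Measure (Fin n → ℝ)) →L[ℂ] Lp ℂ 2 (volume : Measure (Fin n → ℝ)))
    (hTΦ : ∀ f : Lp ℂ 2 (volume : Measure (Fin n → ℝ)),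
      ∀ᵐ x : Fin n → ℝ ∂volume, TΦ f x = ∫ u, Φ u * f ((A u).mulVec x) ∂μ)
    (hTΨ : ∀ f : Lp ℂ 2 (volume : Measure (Fin n → ℝ)),
      ∀ᵐ x : Fin n → ℝ ∂volume, TΨ f x = ∫ v, Ψ v * f ((B v).mulVec x) ∂μ)
    (φ ψ : (Fin n → ℝ) → ℂ)
    (hφ : ∀ s : Fin n → ℝ,
      φ s = ∫ u, Φ u * ∏ j, (a j u : ℂ) ^ (-(1 / 2 : ℂ) - Complex.I * (s j : ℂ)) ∂μ)
    (hψ : ∀ s : Fin n → ℝ,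
      ψ s = ∫ v, Ψ v * ∏ j, (b j v : ℂ) ^ (-(1 / 2 : ℂ) - Complex.I * (s j : ℂ)) ∂μ) :
    (TΦ ∘L TΨ = 1 ∧ TΨ ∘L TΦ = 1) ↔ ∀ s : Fin n → ℝ, φ s * ψ s = 1 := by
  have hCu : IsUnit C.det :=
    IsUnit.of_mul_eq_one Cᵀ.det (by rw [← det_mul, hC, det_one])
  have hT : ∀ (Θ : Ω → ℂ) (D : Ω → Matrix (Fin n) (Fin n) ℝ) (w : Fin n → Ω → ℝ),
      (∀ᵐ u ∂μ, Θ u ≠ 0 → ∀ j, 0 < w j u) →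
      (∀ᵐ u ∂μ, Θ u ≠ 0 → D u = C⁻¹ * Matrix.diagonal (fun j => w j u) * C) →
      ∀ T : Lp ℂ 2 (volume : Measure (Fin n → ℝ)) →L[ℂ] Lp ℂ 2 (volume : Measure (Fin n → ℝ)),
      (∀ f : Lp ℂ 2 (volume : Measure (Fin n → ℝ)),
        ∀ᵐ x : Fin n → ℝ ∂volume, T f x = ∫ u, Θ u * f ((D u).mulVec x) ∂μ) →
      ∀ f : Lp ℂ 2 (volume : Measure (Fin n → ℝ)),
        ∀ᵐ x, T f x = ∫ u, Θ u * f (conjDiagonal C (positivize w u) *ᵥ x) ∂μ := by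
    intro Θ D w hw hD T hT f
    filter_upwards [hT f] with x hx
    rw [hx]
    refine integral_congr_ae ?_
    filter_upwards [hw, hD] with u h1 h2
    by_cases h : Θ u = 0
    · simp [h]
    · rw [h2 h, positivize_eq (h1 h), conjDiagonal]
  have hTΦ' := hT Φ A a hapos hdiagA TΦ hTΦ
  have hTΨ' := hT Ψ B b hbpos hdiagB TΨ hTΨ
  have ham := measurable_positivize ha
  have hbm := measurable_positivize hb
  have hφ' : ∀ s, φ s = ∫ u, Φ u * mellinKernel s (positivize a u) ∂μ := fun s => by
    rw [hφ s]
    exact integral_congr_ae (mul_ae_eq_positivize (k := id) hapos rfl (mellinKernel s))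
  have hψ' : ∀ s, ψ s = ∫ v, Ψ v * mellinKernel s (positivize b v) ∂μ := fun s => by
    rw [hψ s]
    exact integral_congr_ae (mul_ae_eq_positivize (k := id) hbpos rfl (mellinKernel s))
  have hintA' := hintA.congr (mul_ae_eq_positivize (k := norm) hapos norm_zero
    fun w => (∏ j, w j) ^ (-((1 : ℝ) / 2)))
  have hintB' := hintB.congr (mul_ae_eq_positivize (k := norm) hbpos norm_zero
    fun w => (∏ j, w j) ^ (-((1 : ℝ) / 2)))
  by_cases hΦm : AEStronglyMeasurable Φ μ
  swap
  · refine iff_of_false (fun h => ?_) fun h => ?_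
    · obtain ⟨f, hf0, hf⟩ := exists_ne_zero_map_eq_zero_of_not_aestronglyMeasurable hCu hΦm ham
        (positivize_pos a) hTΦ'
      refine hf0 ?_
      have := congrArg (fun S => S f) h.2
      simpa [hf] using this.symm
    · have h0 : φ 0 = 0 := (hφ' 0).trans <| integral_mul_eq_zero_of_not_aestronglyMeasurable hΦm
        ((measurable_mellinKernel 0).comp ham)
        (Eventually.of_forall fun u => mellinKernel_ne_zero 0 (positivize_pos a u))
      simpa [h0] using h 0
  by_cases hΨm : AEStronglyMeasurable Ψ μ
  swap
  · refine iff_of_false (fun h => ?_) fun h => ?_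
    · obtain ⟨f, hf0, hf⟩ := exists_ne_zero_map_eq_zero_of_not_aestronglyMeasurable hCu hΨm hbm
        (positivize_pos b) hTΨ'
      refine hf0 ?_
      have := congrArg (fun S => S f) h.1
      simpa [hf] using this.symm
    · have h0 : ψ 0 = 0 := (hψ' 0).trans <| integral_mul_eq_zero_of_not_aestronglyMeasurable hΨm
        ((measurable_mellinKernel 0).comp hbm)
        (Eventually.of_forall fun u => mellinKernel_ne_zero 0 (positivize_pos b u))
      simpa [h0] using h 0
  rw [hausdorff_comp_eq_one_iff hCu hΦm hΨm ham hbm (positivize_pos a) (positivize_pos b)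
      hintA' hintB' hTΦ' hTΨ',
    hausdorff_comp_eq_one_iff hCu hΨm hΦm hbm ham (positivize_pos b) (positivize_pos a)
      hintB' hintA' hTΨ' hTΦ']
  simp only [← hφ', ← hψ']
  exact ⟨fun h => h.1, fun h => ⟨h, fun s => by rw [mul_comm]; exact h s⟩⟩
end
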